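/- For every degree d with 6 ≤ d ≤ 12 and every diameter k > 2, there is no almost Moore digraph of degree d and diameter k with self-repeats. -/

import Mathlib

/-- `IsWalkFrom A u v l` : the list `u :: l` is a directed walk from `u` to `v`
along the adjacency relation `A`; the length of the walk is `l.length`. -/
def IsWalkFrom {V : Type} (A : V → V → Prop) (u v : V) (l : List V) : Prop :=
  List.Chain A u l ∧ (u :: l).getLast (List.cons_ne_nil u l) = v

/-- An almost Moore digraph (a `(d,k)`-digraph): a diregular digraph of degree `d > 1`,
diameter `k > 1` and order `d + d² + ⋯ + d^k`, together with its repeat permutation `rep`: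
for every vertex `v`, every vertex `w ≠ rep v` is reached from `v` by exactly one walk of
length at most `k`, while `rep v` is reached by exactly two such walks, at least one of
which has length `k`.  The map `rep` is an automorphism of the digraph. -/
structure AlmostMooreDigraph (d k : ℕ) where
  hd : 1 < d
  hk : 1 < k
  V : Type
  [fintypeV : Fintype V]
  [decEqV : DecidableEq V]
  Adj : V → V → Prop
  [adjDec : DecidableRel Adj]
  loopless : ∀ v, ¬ Adj v v
  out_deg : ∀ v, {w | Adj v w}.ncard = d
  in_deg : ∀ v, {w | Adj w v}.ncard = d
  reach : ∀ u v, ∃ l, IsWalkFrom Adj u v l ∧ l.length ≤ k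
  diam : ∃ u v, ∀ l, IsWalkFrom Adj u v l → k ≤ l.length
  card_eq : Fintype.card V = ∑ i ∈ Finset.range k, d ^ (i + 1)
  rep : V → V
  rep_spec : ∀ v w, w ≠ rep v → ∃! l, IsWalkFrom Adj v w l ∧ l.length ≤ k
  rep_two : ∀ v, ∃ l₁ l₂, l₁ ≠ l₂ ∧
      IsWalkFrom Adj v (rep v) l₁ ∧ l₁.length ≤ k ∧
      IsWalkFrom Adj v (rep v) l₂ ∧ l₂.length ≤ k ∧
      (l₁.length = k ∨ l₂.length = k) ∧
      (∀ l, IsWalkFrom Adj v (rep v) l → l.length ≤ k → l = l₁ ∨ l = l₂)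
  rep_bijective : Function.Bijective rep
  rep_adj : ∀ u v, Adj u v ↔ Adj (rep u) (rep v)

attribute [instance] AlmostMooreDigraph.fintypeV AlmostMooreDigraph.decEqV
  AlmostMooreDigraph.adjDec

/-- `ordRep M v` : the smallest `t ≥ 1` with `rep^t v = v`. -/
noncomputable def ordRep {d k : ℕ} (M : AlmostMooreDigraph d k) (v : M.V) : ℕ :=
  sInf {t | 0 < t ∧ M.rep^[t] v = v}

/-- The vertex set of the subdigraph `H_α`: vertices whose order under the repeat
permutation divides `2^t * α` for some `t ≥ 0`. -/
def Hset {d k : ℕ} (M : AlmostMooreDigraph d k) (α : ℕ) : Set M.V :=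
  {v | ∃ t : ℕ, ordRep M v ∣ 2 ^ t * α}

section

open Polynomial

universe u

theorem Matrix.trace_aeval_eq_sum_roots_charpoly {n K : Type*} [Fintype n] [DecidableEq n]
    [Field K] [IsAlgClosed K] (M : Matrix n n K) (q : K[X]) :
    (aeval M q).trace = (M.charpoly.roots.map fun z => q.eval z).sum := by
  have key : (aeval M q).charpoly = (M.charpoly.roots.map fun z => X - C (q.eval z)).prod := by
    apply Polynomial.funext
    intro t
    rw [Matrix.eval_charpoly, eval_multiset_prod, Multiset.map_map]
    have h1 : Matrix.scalar n t - aeval M q = aeval M (C t - q) := by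
      simp [Matrix.algebraMap_eq_diagonal, Matrix.scalar_apply]
    rw [h1]
    have h2 : ∀ p : K[X], (aeval M p).det = (M.charpoly.roots.map fun z => p.eval z).prod := by
      intro p
      have hp := IsAlgClosed.splits p
      rw [hp.eq_prod_roots]
      generalize p.roots = s
      have hcard : M.charpoly.roots.card = Fintype.card n := by
        rw [← M.charpoly_natDegree_eq_dim]
        exact (IsAlgClosed.splits M.charpoly).natDegree_eq_card_roots.symm
      induction s using Multiset.induction_on with
      | empty => 
        simp [Matrix.algebraMap_eq_diagonal, Matrix.det_diagonal, hcard]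
      | cons a s ih =>
        have : C p.leadingCoeff * (Multiset.map (fun a => X - C a) (a ::ₘ s)).prod = 
          (X - C a) * (C p.leadingCoeff * (Multiset.map (fun a => X - C a) s).prod) := by
          simp; ring
        rw [this, map_mul, Matrix.det_mul, ih]
        simp only [eval_mul, Multiset.prod_map_mul]
        congr 1
        have h3 : aeval M (X - C a) = - (Matrix.scalar n a - M) := by
          simp [Matrix.algebraMap_eq_diagonal, Matrix.scalar_apply]
        rw [h3, Matrix.det_neg, ← Matrix.eval_charpoly, 
          (IsAlgClosed.splits M.charpoly).eq_prod_roots_of_monic M.charpoly_monic,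
           eval_multiset_prod, Multiset.map_map, ← hcard]
        rw [← (IsAlgClosed.splits M.charpoly).eq_prod_roots_of_monic M.charpoly_monic]
        generalize M.charpoly.roots = r
        induction r using Multiset.induction_on with
        | empty => simp
        | cons b r ih2 => 
          simp only [Multiset.map_cons, Multiset.prod_cons, ← ih2, Multiset.card_cons]
          simp; ring
    rw [h2]
    simp
  rw [Matrix.trace_eq_sum_roots_charpoly, key]
  have := roots_multiset_prod_X_sub_C (M.charpoly.roots.map fun z => q.eval z)
  rw [Multiset.map_map] at this
  exact congrArg Multiset.sum this

theorem Matrix.aeval_map_map {n K L : Type*} [Fintype n] [DecidableEq n] [Field K] [Field L]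
    [Algebra K L] (M : Matrix n n K) (q : K[X]) :
    aeval (M.map (algebraMap K L)) (q.map (algebraMap K L)) =
      (aeval M q).map (algebraMap K L) := by
  rw [← RingHom.mapMatrix_apply, ← RingHom.mapMatrix_apply, aeval_def, eval₂_map, aeval_def,
    hom_eval₂]
  congr 1
  ext x i j
  by_cases hij : i = j <;> simp [Matrix.algebraMap_matrix_apply, hij]

theorem Matrix.trace_aeval_eq_sum_aroots_charpoly {n K : Type*} (L : Type*) [Fintype n]
    [DecidableEq n] [Field K] [Field L] [Algebra K L] [IsAlgClosed L] (M : Matrix n n K)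
    (q : K[X]) :
    algebraMap K L (aeval M q).trace = ((M.charpoly.aroots L).map fun z => aeval z q).sum := by
  have h := Matrix.trace_aeval_eq_sum_roots_charpoly (M.map (algebraMap K L))
    (q.map (algebraMap K L))
  rw [Matrix.charpoly_map, Matrix.aeval_map_map] at h
  simp only [eval_map_algebraMap] at h
  rw [aroots, ← h]
  exact AddMonoidHom.map_trace (algebraMap K L).toAddMonoidHom _

/-- The trace of a polynomial expression in the generator of a power basis. -/
theorem PowerBasis.trace_aeval_gen_eq_sum_aroots {K E : Type*} (L : Type*) [Field K] [Field E]
    [Algebra K E] [Field L] [Algebra K L] [IsAlgClosed L] (pb : PowerBasis K E) (q : K[X]) :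
    algebraMap K L (Algebra.trace K E (aeval pb.gen q)) =
      (((minpoly K pb.gen).aroots L).map fun z => aeval z q).sum := by
  rw [← charpoly_leftMulMatrix pb, ← Matrix.trace_aeval_eq_sum_aroots_charpoly,
    Algebra.trace_eq_matrix_trace pb.basis, ← Polynomial.aeval_algHom_apply]

theorem Polynomial.dvd_of_irreducible_of_dvd_charpoly {n K : Type*} [Field K] [Fintype n]
    [DecidableEq n]
    {B : Matrix n n K} {w g : K[X]} (hw : aeval B w = 0) (hg : Irreducible g)
    (hgd : g ∣ B.charpoly) : g ∣ w := by
  cases isEmpty_or_nonempty n with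
  | inl h => exact absurd (isUnit_of_dvd_one (by simpa using hgd)) hg.not_isUnit
  | inr h =>
    obtain ⟨z, hz⟩ := IsAlgClosed.exists_aeval_eq_zero (AlgebraicClosure K) g
      (degree_pos_of_irreducible hg).ne'
    refine (Dvd.intro _ (minpoly.eq_of_irreducible hg hz)).trans (minpoly.dvd_iff.2 ?_)
    have h1 : IsRoot (B.map (algebraMap K (AlgebraicClosure K))).charpoly z := by
      rw [Matrix.charpoly_map, IsRoot, eval_map_algebraMap]
      exact aeval_eq_zero_of_dvd_aeval_eq_zero hgd hz
    rw [← Matrix.mem_spectrum_iff_isRoot_charpoly] at h1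
    have h2 := spectrum.subset_polynomial_aeval (B.map (algebraMap K (AlgebraicClosure K)))
      (w.map (algebraMap K (AlgebraicClosure K))) ⟨z, h1, rfl⟩
    rw [Matrix.aeval_map_map, hw] at h2
    simpa [spectrum.zero_eq, Matrix.map_zero] using h2

theorem Matrix.trace_aeval_eq_zero {n : Type*} {K : Type u} [Field K] [Fintype n] [DecidableEq n]
    (B : Matrix n n K) (w q : K[X]) (hw : aeval B w = 0)
    (h : ∀ (E : Type u) [Field E] [Algebra K E] [FiniteDimensional K E] (x : E),
      IntermediateField.adjoin K {x} = ⊤ →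
      aeval x w = 0 → Algebra.trace K E (aeval x q) = 0) : (aeval B q).trace = 0 := by
  apply (algebraMap K (AlgebraicClosure K)).injective
  rw [Matrix.trace_aeval_eq_sum_aroots_charpoly, map_zero]
  have main : ∀ s : Multiset K[X], (∀ g ∈ s, Irreducible g ∧ g.Monic ∧ g ∣ B.charpoly) →
      ((s.prod.aroots (AlgebraicClosure K)).map fun z => aeval z q).sum = 0 := by
    intro s
    induction s using Multiset.induction_on with
    | empty => simp
    | cons g s ih =>
      intro hs
      obtain ⟨hg, hgm, hgd⟩ := hs g (by simp)
      have hs' : ∀ g ∈ s, Irreducible g ∧ g.Monic ∧ g ∣ B.charpoly := fun g hg => hs g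
        (by simp [hg])
      have hsm : s.prod.Monic := by
        simpa using monic_multiset_prod_of_monic s id (fun i hi => (hs' i hi).2.1)
      rw [Multiset.prod_cons, aroots_mul (mul_ne_zero hgm.ne_zero hsm.ne_zero), Multiset.map_add,
        Multiset.sum_add, ih hs', add_zero]
      have : Fact (Irreducible g) := ⟨hg⟩
      have : FiniteDimensional K (AdjoinRoot g) := (AdjoinRoot.powerBasis hgm.ne_zero).finite
      have hmin : minpoly K (AdjoinRoot.powerBasis hgm.ne_zero).gen = g := by
        rw [AdjoinRoot.powerBasis_gen, AdjoinRoot.minpoly_root hgm.ne_zero, hgm.leadingCoeff]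
        simp
      rw [← hmin, ← PowerBasis.trace_aeval_gen_eq_sum_aroots, h _ _ _ _, map_zero]
      · exact IntermediateField.adjoin_root_eq_top g
      · rw [← minpoly.dvd_iff, hmin]
        exact Polynomial.dvd_of_irreducible_of_dvd_charpoly hw hg hgd
  classical
  have hprod := UniqueFactorizationMonoid.prod_normalizedFactors_eq
    B.charpoly_monic.ne_zero
  rw [B.charpoly_monic.normalize_eq_self] at hprod
  rw [← hprod]
  apply main
  intro g hg
  have hgi := UniqueFactorizationMonoid.irreducible_of_normalized_factor g hg
  exact ⟨hgi, (normalize_eq_self_iff_monic hgi.ne_zero).1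
    (UniqueFactorizationMonoid.normalize_normalized_factor g hg),
    UniqueFactorizationMonoid.dvd_of_mem_normalizedFactors hg⟩

theorem Multiset.sum_map_pow_eq_zero_of_esymm {R : Type*} [CommRing R] (s : Multiset R) {l : ℕ}
    (hl : 0 < l) (h : ∀ i, 0 < i → i ≤ l → s.esymm i = 0) : (s.map (· ^ l)).sum = 0 := by
  classical
  let f : s → R := fun x => x.1
  have hf : Finset.univ.val.map f = s := s.map_univ_coe
  have key := congrArg (MvPolynomial.aeval f) (MvPolynomial.psum_eq_mul_esymm_sub_sum s R l hl)
  have hp : MvPolynomial.aeval f (MvPolynomial.psum s R l) = (s.map (· ^ l)).sum := by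
    conv_rhs => rw [← hf, Multiset.map_map]
    rw [MvPolynomial.psum, map_sum]
    simp only [map_pow, MvPolynomial.aeval_X]
    rfl
  rw [← hp, key]
  simp only [map_sub, map_mul, map_sum, MvPolynomial.aeval_esymm_eq_multiset_esymm, hf]
  rw [h l hl le_rfl, mul_zero, zero_sub, neg_eq_zero]
  apply Finset.sum_eq_zero
  intro a ha
  simp only [Finset.mem_filter, Set.mem_Ioo] at ha
  rw [h a.1 ha.2.1 ha.2.2.le, mul_zero, zero_mul]

theorem Polynomial.sum_roots_pow_eq_zero {L : Type*} [Field L] [IsAlgClosed L] {f : L[X]}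
    (hf : f.Monic) {l : ℕ} (hl : 0 < l) (hln : l ≤ f.natDegree)
    (h : ∀ i, 0 < i → i ≤ l → f.coeff (f.natDegree - i) = 0) :
    (f.roots.map (· ^ l)).sum = 0 := by
  have hcard := (IsAlgClosed.splits f).natDegree_eq_card_roots.symm
  apply Multiset.sum_map_pow_eq_zero_of_esymm _ hl
  intro i hi hil
  have h1 := coeff_eq_esymm_roots_of_card hcard (k := f.natDegree - i) (by omega)
  rw [h i hi hil, hf.leadingCoeff, Nat.sub_sub_self (by omega)] at h1
  simpa using h1.symm

theorem Polynomial.coeff_trinomial_mul_conj {K : Type*} [CommRing K] (z z' : K) (N : ℕ) :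
    let p : K[X] := (X ^ (N + 4) - C z * X + C (z - 1)) *
      (1 - C z' * X ^ (N + 3) + C (z' - 1) * X ^ (N + 4))
    p.coeff 0 = z - 1 ∧ p.coeff 1 = - z ∧ p.coeff (N + 3) = - ((z - 1) * z') ∧
      p.coeff (N + 4) = 1 + z * z' + (z - 1) * (z' - 1) := by
  intro p
  have hp : p = X ^ (N + 4) - C z * X + C (z - 1)
      + C (-z') * X ^ (2 * N + 7) + C (z * z') * X ^ (N + 4) + C (- ((z - 1) * z')) * X ^ (N + 3)
      + C (z' - 1) * X ^ (2 * N + 8) + C (-(z * (z' - 1))) * X ^ (N + 5)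
      + C ((z - 1) * (z' - 1)) * X ^ (N + 4) := by
    simp only [p, C_mul, C_sub, C_neg, C_1]
    ring
  rw [hp]
  refine ⟨?_, ?_, ?_, ?_⟩ <;>
    simp only [coeff_add, coeff_sub, coeff_X_pow, coeff_C_mul, coeff_X, coeff_C] <;>
    norm_num <;> (try split_ifs) <;> first | omega | simp

theorem Polynomial.conj_reciprocal_factor_of_trinomial {K : Type*} [Field K] (c : K →+* K)
    (hc : ∀ x, c (c x) = x) (τ : K →+ ℝ) (O : Subring K) (hcO : ∀ x ∈ O, c x ∈ O) (φ : ℝ)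
    (hφ : 0 < φ) (h1 : ∀ x ∈ O, x ≠ 0 → φ ≤ τ (x * c x)) {z : K} (hz : z * c z = 1) (hz1 : z ≠ 1)
    (h2 : ∀ x ∈ O, ∀ y ∈ O, x * c y = z - 1 →
      τ (4 - z - c z) < τ (x * c x) + τ (y * c y) + 2 * φ)
    {n : ℕ} (hn : 4 ≤ n) (u v : K[X]) (hu : ∀ i, u.coeff i ∈ O) (hv : ∀ i, v.coeff i ∈ O)
    (huv : u * v = X ^ n - C z * X + C (z - 1)) :
    ∃ κ : K, reflect v.natDegree (v.map c) = C κ * v ∨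
      reflect u.natDegree (u.map c) = C κ * u := by
  obtain ⟨N, rfl⟩ : ∃ N, n = N + 4 := ⟨n - 4, by omega⟩
  set f : K[X] := X ^ (N + 4) - C z * X + C (z - 1) with hf
  have hfdeg : f.natDegree = N + 4 := by
    rw [hf]; compute_degree!
    simp [show N + 4 ≠ 1 by omega]
  have hf0 : f ≠ 0 := by
    intro h; rw [h] at hfdeg; simp at hfdeg
  have hu0 : u ≠ 0 := by rintro rfl; simp at huv; exact hf0 huv.symm
  have hv0 : v ≠ 0 := by rintro rfl; simp at huv; exact hf0 huv.symm
  have hdeg : u.natDegree + v.natDegree = N + 4 := by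
    rw [← natDegree_mul hu0 hv0, huv, hfdeg]
  set u' := reflect u.natDegree (u.map c) with hu'
  set v' := reflect v.natDegree (v.map c) with hv'
  have hcc : ∀ p : K[X], (p.map c).map c = p := fun p => by ext; simp [hc]
  set F : K[X] := 1 - C (c z) * X ^ (N + 3) + C (c z - 1) * X ^ (N + 4) with hF
  have hF' : reflect (N + 4) (f.map c) = F := by
    have : f.map c = C 1 * X ^ (N + 4) - C (c z) * X ^ 1 + C (c z - 1) * X ^ 0 := by simp [hf]
    rw [this, reflect_add, reflect_sub, reflect_C_mul_X_pow, reflect_C_mul_X_pow,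
      reflect_C_mul_X_pow, revAt_le le_rfl, revAt_le (by omega), revAt_le (by omega)]
    simp [hF]
  have huv' : u' * v' = F := by
    rw [← hF', ← huv, Polynomial.map_mul, ← hdeg,
      reflect_mul _ _ natDegree_map_le natDegree_map_le]
  set G := u * v' with hG
  have hGr : reflect (N + 4) (G.map c) = u' * v := by
    rw [hG, Polynomial.map_mul, ← hdeg, reflect_mul _ _ natDegree_map_le, hv', ← reflect_map, hcc,
      reflect_reflect]
    rw [hv', ← reflect_map, hcc]
    exact natDegree_reflect_le.trans (by simp)
  have hGG : G * reflect (N + 4) (G.map c) = f * F := by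
    rw [hGr, ← huv, ← huv']; ring
  obtain ⟨e0, e1, e3, e4⟩ := coeff_trinomial_mul_conj z (c z) N
  rw [← hf, ← hF, ← hGG] at e0 e1 e3 e4
  have hGO : ∀ i, G.coeff i ∈ O := by
    intro i
    rw [hG, coeff_mul]
    refine sum_mem fun x _ => mul_mem (hu _) ?_
    rw [hv', coeff_reflect, coeff_map]
    exact hcO _ (hv _)
  have hGdeg : G.natDegree ≤ N + 4 := by
    rw [← hdeg]
    refine natDegree_mul_le.trans (Nat.add_le_add_left ?_ _)
    exact natDegree_reflect_le.trans (by simp)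
  have hco : ∀ m ≤ N + 4, (G * reflect (N + 4) (G.map c)).coeff m =
      ∑ i ∈ Finset.range (m + 1), G.coeff i * c (G.coeff (N + 4 - (m - i))) := by
    intro m hm
    rw [coeff_mul, Finset.Nat.sum_antidiagonal_eq_sum_range_succ_mk]
    refine Finset.sum_congr rfl fun i _ => ?_
    rw [coeff_reflect, coeff_map, revAt_le (by omega)]
  rw [hco _ (by omega)] at e0 e1 e3 e4
  set g := G.coeff with hg
  simp only [Finset.sum_range_succ, Finset.range_zero, Finset.sum_empty, zero_add] at e0 e1
  have ht : ∀ i, 0 ≤ τ (g i * c (g i)) := by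
    intro i
    by_cases h : g i = 0
    · simp [h]
    · exact hφ.le.trans (h1 _ (hGO i) h)
  have hsum : ∑ i ∈ Finset.range (N + 5), τ (g i * c (g i)) = τ (4 - z - c z) := by
    rw [← map_sum]
    congr 1
    have : (1 : K) + z * c z + (z - 1) * (c z - 1) = 4 - z - c z := by
      linear_combination 2 * hz
    rw [← this, ← e4]
    refine Finset.sum_congr rfl fun i hi => ?_
    rw [Finset.mem_range] at hi
    rw [show N + 4 - (N + 4 - i) = i by omega]
  have hz1' : z - 1 ≠ 0 := sub_ne_zero.2 hz1
  have hz0 : z ≠ 0 := left_ne_zero_of_mul_eq_one hz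
  have hlow := h2 _ (hGO 0) _ (hGO (N + 4)) e0
  have hmid : ∀ i j, 0 < i → i < j → j < N + 4 → g i ≠ 0 → g j ≠ 0 → False := by
    intro i j hi hij hj hgi hgj
    have hsub : ({0, i, j, N + 4} : Finset ℕ) ⊆ Finset.range (N + 5) := by
      intro x; simp; omega
    have := Finset.sum_le_sum_of_subset_of_nonneg (f := fun i => τ (g i * c (g i))) hsub
      (fun i _ _ => ht i)
    rw [Finset.sum_insert (by simp; omega), Finset.sum_insert (by simp; omega),
      Finset.sum_insert (by simp; omega), Finset.sum_singleton, hsum] at this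
    have := h1 _ (hGO i) hgi
    have := h1 _ (hGO j) hgj
    linarith
  have hg0 : g 0 ≠ 0 := by
    intro h
    simp [h] at e0
    exact hz1' e0.symm
  have hgn : g (N + 4) ≠ 0 := by
    intro h
    simp [h] at e0
    exact hz1' e0.symm
  have hcz : c z = z⁻¹ := eq_inv_of_mul_eq_one_right hz
  by_cases hone : g 1 = 0
  · have hlast : g (N + 3) ≠ 0 := by
      intro h
      simp [hone, h] at e1
      exact hz0 e1
    have hzero : ∀ i, 0 < i → i < N + 3 → g i = 0 := fun i hi hi2 => by
      by_contra h
      exact hmid i (N + 3) hi hi2 (by omega) h hlast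
    have e3' : g (N + 3) * c (g (N + 4)) = -((z - 1) * c z) := by
      rw [← e3, Finset.sum_eq_single (N + 3)]
      · simp
      · intro i hi hne
        rw [Finset.mem_range] at hi
        rcases Nat.eq_zero_or_pos i with rfl | hi0
        · rw [show N + 4 - (N + 3 - 0) = 1 by omega, hone]; simp
        · rw [hzero i hi0 (by omega), zero_mul]
      · simp
    have e1' : g 0 * c (g (N + 3)) = -z := by simpa [hone] using e1
    have e0' : g 0 * c (g (N + 4)) = z - 1 := by simpa using e0
    have k1 : g (N + 3) = - (c z) * g 0 := by
      apply mul_left_cancel₀ hz1'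
      linear_combination g 0 * e3' - g (N + 3) * e0'
    have k2 : g 0 * c (g 0) = 1 := by
      rw [k1, map_mul, map_neg, hc] at e1'
      apply mul_left_cancel₀ hz0
      linear_combination - e1'
    have k3 : g (N + 4) = g 0 * (c z - 1) := by
      have := congrArg c e0'
      rw [map_mul, hc, map_sub, map_one] at this
      linear_combination g 0 * this - g (N + 4) * k2
    have hGF : G = C (g 0) * F := by
      ext i
      simp only [hF, mul_add, mul_sub, coeff_add, coeff_sub, coeff_C_mul, coeff_one, coeff_X_pow]
      rcases lt_trichotomy i (N + 4) with h | h | h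
      · rcases Nat.eq_zero_or_pos i with rfl | hi0
        · simp [hg]
        · rcases (show i = N + 3 ∨ i < N + 3 by omega) with rfl | h'
          · rw [← hg, k1]; simp; ring
          · rw [← hg, hzero i hi0 h', if_neg (by omega), if_neg (by omega), if_neg (by omega)]
            simp
      · subst h
        rw [← hg, k3]; simp
      · rw [coeff_eq_zero_of_natDegree_lt (by omega), if_neg (by omega), if_neg (by omega),
          if_neg (by omega)]
        simp
    refine ⟨c (g 0), Or.inr ?_⟩
    have hv'0 : v' ≠ 0 := by
      rw [hv', Ne, reflect_eq_zero_iff]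
      simpa using hv0
    apply mul_right_cancel₀ hv'0
    rw [huv', mul_assoc, ← hG, hGF, ← mul_assoc, ← C_mul, mul_comm (c (g 0)), k2]
    simp
  · have hzero : ∀ i, 1 < i → i < N + 4 → g i = 0 := fun i hi hi2 => by
      by_contra h
      exact hmid 1 i (by omega) hi hi2 hone h
    have e3' : g 0 * c (g 1) = -((z - 1) * c z) := by
      rw [← e3, Finset.sum_eq_single 0]
      · rw [show N + 4 - (N + 3 - 0) = 1 by omega]
      · intro i hi hne
        rw [Finset.mem_range] at hi
        rcases (show i = 1 ∨ 1 < i by omega) with rfl | hi0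
        · rw [show N + 4 - (N + 3 - 1) = 2 by omega, hzero 2 (by omega) (by omega)]; simp
        · rw [hzero i hi0 (by omega), zero_mul]
      · simp
    have e1' : g 1 * c (g (N + 4)) = -z := by
      simpa [hzero (N + 3) (by omega) (by omega)] using e1
    have e0' : g 0 * c (g (N + 4)) = z - 1 := by simpa using e0
    have e0'' : c (g 0) * g (N + 4) = c z - 1 := by simpa [hc] using congrArg c e0'
    have e3'' : c (g 0) * g 1 = -((c z - 1) * z) := by simpa [hc] using congrArg c e3'
    have hz1'' : c z - 1 ≠ 0 := fun h => hz1' (by simpa [hc] using congrArg c h)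
    have k1 : g 1 = - z * g (N + 4) := by
      apply mul_left_cancel₀ hz1''
      linear_combination g (N + 4) * e3'' - g 1 * e0''
    have k2 : g (N + 4) * c (g (N + 4)) = 1 := by
      rw [k1] at e1'
      apply mul_left_cancel₀ hz0
      linear_combination - e1'
    have k3 : g 0 = g (N + 4) * (z - 1) := by
      linear_combination g (N + 4) * e0' - g 0 * k2
    have hGF : G = C (g (N + 4)) * f := by
      ext i
      simp only [hf, mul_add, mul_sub, coeff_add, coeff_sub, coeff_C_mul, coeff_X_pow, coeff_X,
        coeff_C]
      rcases lt_trichotomy i (N + 4) with h | h | h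
      · rcases Nat.eq_zero_or_pos i with rfl | hi0
        · rw [← hg, k3]; simp
        · rcases (show i = 1 ∨ 1 < i by omega) with rfl | h'
          · rw [← hg, k1]; simp; ring
          · rw [← hg, hzero i h' h, if_neg (by omega), if_neg (by omega), if_neg (by omega)]
            simp
      · subst h
        rw [← hg]; simp
      · rw [coeff_eq_zero_of_natDegree_lt (by omega), if_neg (by omega), if_neg (by omega),
          if_neg (by omega)]
        simp
    refine ⟨g (N + 4), Or.inl ?_⟩
    apply mul_left_cancel₀ hu0
    rw [← hG, hGF, ← huv]
    ring

theorem Polynomial.dvd_of_conj_reciprocal_of_dvd_trinomial {K : Type*} [Field K] (c : K →+* K)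
    {z : K} (hz : z * c z = 1) (hz1 : z ≠ 1) {n : ℕ} (hn : 2 ≤ n) {u v : K[X]} {κ : K}
    (huv : u * v = X ^ n - C z * X + C (z - 1))
    (hκ : reflect u.natDegree (u.map c) = C κ * u) : u ∣ (X - 1) * (X + C (c z)) := by
  obtain ⟨N, rfl⟩ : ∃ N, n = N + 2 := ⟨n - 2, by omega⟩
  set f : K[X] := X ^ (N + 2) - C z * X + C (z - 1) with hf
  have hfdeg : f.natDegree = N + 2 := by
    rw [hf]; compute_degree!
    simp [show N + 2 ≠ 1 by omega]
  have hf0 : f ≠ 0 := by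
    intro h; rw [h] at hfdeg; simp at hfdeg
  have hu0 : u ≠ 0 := by rintro rfl; simp at huv; exact hf0 huv.symm
  have hv0 : v ≠ 0 := by rintro rfl; simp at huv; exact hf0 huv.symm
  have hdeg : u.natDegree + v.natDegree = N + 2 := by
    rw [← natDegree_mul hu0 hv0, huv, hfdeg]
  have hF' : reflect (N + 2) (f.map c) = 1 - C (c z) * X ^ (N + 1) + C (c z - 1) * X ^ (N + 2) := by
    have : f.map c = C 1 * X ^ (N + 2) - C (c z) * X ^ 1 + C (c z - 1) * X ^ 0 := by simp [hf]
    rw [this, reflect_add, reflect_sub, reflect_C_mul_X_pow, reflect_C_mul_X_pow,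
      reflect_C_mul_X_pow, revAt_le le_rfl, revAt_le (by omega), revAt_le (by omega)]
    simp
  have huF : u ∣ reflect (N + 2) (f.map c) := by
    rw [← huv, Polynomial.map_mul, ← hdeg, reflect_mul _ _ natDegree_map_le natDegree_map_le, hκ]
    exact (dvd_mul_left u (C κ)).mul_right _
  have huf : u ∣ f := Dvd.intro _ huv
  have hz1' : 1 - z ≠ 0 := sub_ne_zero.2 hz1.symm
  have hC : C z * C (c z) = (1 : K[X]) := by rw [← C_mul, hz, C_1]
  have key : X * reflect (N + 2) (f.map c) - ((C (c z) - 1) * X - C (c z)) * f =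
      C (1 - z) * ((X - 1) * (X + C (c z))) := by
    rw [hF', hf]
    simp only [C_sub, C_1]
    linear_combination (X ^ 2 - X) * hC
  have h := dvd_sub (huF.mul_left X) (huf.mul_left ((C (c z) - 1) * X - C (c z)))
  rw [key] at h
  exact (isUnit_C.2 hz1'.isUnit).dvd_mul_left.1 h

theorem Finset.card_pow_mul_prod_le_sum_pow {ι : Type*} [Fintype ι] [Nonempty ι] (a : ι → ℝ)
    (ha : ∀ i, 0 ≤ a i) :
    (Fintype.card ι : ℝ) ^ Fintype.card ι * ∏ i, a i ≤ (∑ i, a i) ^ Fintype.card ι := by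
  have hpos : (0 : ℝ) < Fintype.card ι := by exact_mod_cast Fintype.card_pos
  have h := Real.geom_mean_le_arith_mean Finset.univ (fun _ => 1) a (by simp) (by simpa using hpos)
    (fun i _ => ha i)
  simp only [Real.rpow_one, Finset.sum_const, Finset.card_univ, nsmul_eq_mul, mul_one,
    one_mul] at h
  have hp : 0 ≤ ∏ i, a i := Finset.prod_nonneg fun i _ => ha i
  have h' := pow_le_pow_left₀ (Real.rpow_nonneg hp _) h (Fintype.card ι)
  rw [Real.rpow_inv_natCast_pow hp Fintype.card_ne_zero, div_pow, le_div_iff₀ (by positivity)] at h'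
  linarith

theorem Algebra.trace_mul_conj_eq_sum {K : Type*} [Field K] [Algebra ℚ K] [FiniteDimensional ℚ K]
    {c : K → K} (hc : ∀ (σ : K →ₐ[ℚ] ℂ) x, σ (c x) = starRingEnd ℂ (σ x)) (x : K) :
    ((Algebra.trace ℚ K (x * c x) : ℚ) : ℝ) = ∑ σ : K →ₐ[ℚ] ℂ, ‖σ x‖ ^ 2 := by
  have h := trace_eq_sum_embeddings (K := ℚ) ℂ (x := x * c x)
  simp only [map_mul, hc, Complex.mul_conj'] at h
  have h' : (((Algebra.trace ℚ K (x * c x) : ℚ) : ℝ) : ℂ) =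
      ((∑ σ : K →ₐ[ℚ] ℂ, ‖σ x‖ ^ 2 : ℝ) : ℂ) := by
    push_cast
    simpa using h
  exact_mod_cast h'

theorem Algebra.abs_norm_eq_prod {K : Type*} [Field K] [Algebra ℚ K] [FiniteDimensional ℚ K]
    (x : K) : |((Algebra.norm ℚ x : ℚ) : ℝ)| = ∏ σ : K →ₐ[ℚ] ℂ, ‖σ x‖ := by
  have h := congrArg (fun z : ℂ => ‖z‖) (Algebra.norm_eq_prod_embeddings ℚ ℂ x)
  simp only [norm_prod] at h
  rw [← h]
  simp

theorem Algebra.one_le_abs_norm {K : Type*} [Field K] [Algebra ℚ K] [FiniteDimensional ℚ K]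
    {x : K} (hx : IsIntegral ℤ x) (hx0 : x ≠ 0) : 1 ≤ |((Algebra.norm ℚ x : ℚ) : ℝ)| := by
  obtain ⟨m, hm⟩ := (IsIntegrallyClosed.isIntegral_iff (R := ℤ) (K := ℚ)).1
    (Algebra.isIntegral_norm ℚ hx)
  have hm0 : m ≠ 0 := by
    rintro rfl
    exact (Algebra.norm_ne_zero_iff (R := ℚ).2 hx0) (by rw [← hm, map_zero])
  rw [← hm]
  have := Int.one_le_abs hm0
  simp
  exact_mod_cast this

theorem Algebra.finrank_le_sum_sq {K : Type*} [Field K] [Algebra ℚ K] [FiniteDimensional ℚ K]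
    {x : K} (hx : IsIntegral ℤ x) (hx0 : x ≠ 0) :
    (Module.finrank ℚ K : ℝ) ≤ ∑ σ : K →ₐ[ℚ] ℂ, ‖σ x‖ ^ 2 := by
  have hcard := AlgHom.card ℚ K ℂ
  have : Nonempty (K →ₐ[ℚ] ℂ) := by
    rw [← Fintype.card_pos_iff, hcard]; exact Module.finrank_pos
  have h := Finset.card_pow_mul_prod_le_sum_pow (fun σ : K →ₐ[ℚ] ℂ => ‖σ x‖ ^ 2)
    (fun _ => by positivity)
  rw [Finset.prod_pow, ← Algebra.abs_norm_eq_prod, hcard] at h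
  have h1 := Algebra.one_le_abs_norm hx hx0
  refine le_of_pow_le_pow_left₀ (Module.finrank_pos (R := ℚ) (M := K)).ne' (by positivity)
    (le_trans ?_ h)
  exact le_mul_of_one_le_right (by positivity) (one_le_pow₀ h1)

theorem Algebra.lt_sum_sq_add_sum_sq {K : Type*} [Field K] [Algebra ℚ K] [FiniteDimensional ℚ K]
    {c : K → K} (hc : ∀ (σ : K →ₐ[ℚ] ℂ) x, σ (c x) = starRingEnd ℂ (σ x)) {x y w : K} {t : ℝ}
    (ht : t ^ Module.finrank ℚ K <
      (Module.finrank ℚ K : ℝ) ^ Module.finrank ℚ K * |((Algebra.norm ℚ w : ℚ) : ℝ)|)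
    (hxy : x * c y = w) :
    2 * t < ∑ σ : K →ₐ[ℚ] ℂ, ‖σ x‖ ^ 2 + ∑ σ : K →ₐ[ℚ] ℂ, ‖σ y‖ ^ 2 := by
  have hcard := AlgHom.card ℚ K ℂ
  have : Nonempty (K →ₐ[ℚ] ℂ) := by
    rw [← Fintype.card_pos_iff, hcard]; exact Module.finrank_pos
  have h := Finset.card_pow_mul_prod_le_sum_pow (fun σ : K →ₐ[ℚ] ℂ => ‖σ w‖)
    (fun _ => by positivity)
  rw [← Algebra.abs_norm_eq_prod, hcard] at h
  have h1 : t < ∑ σ : K →ₐ[ℚ] ℂ, ‖σ w‖ :=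
    lt_of_pow_lt_pow_left₀ _ (Finset.sum_nonneg fun _ _ => norm_nonneg _) (ht.trans_le h)
  have h2 : 2 * ∑ σ : K →ₐ[ℚ] ℂ, ‖σ w‖ ≤
      ∑ σ : K →ₐ[ℚ] ℂ, ‖σ x‖ ^ 2 + ∑ σ : K →ₐ[ℚ] ℂ, ‖σ y‖ ^ 2 := by
    rw [Finset.mul_sum, ← Finset.sum_add_distrib]
    refine Finset.sum_le_sum fun σ _ => ?_
    rw [← hxy, map_mul, hc, norm_mul, RCLike.norm_conj]
    nlinarith [sq_nonneg (‖σ x‖ - ‖σ y‖)]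
  linarith

/-- Complex conjugation on a cyclotomic field. -/
theorem IsCyclotomicExtension.exists_conj {K : Type*} [Field K] [Algebra ℚ K] {i : ℕ} [NeZero i]
    [IsCyclotomicExtension {i} ℚ K] {ζ : K} (hζ : IsPrimitiveRoot ζ i) :
    ∃ c : K ≃ₐ[ℚ] K, c ζ = ζ⁻¹ ∧ (∀ x, c (c x) = x) ∧
      ∀ (σ : K →ₐ[ℚ] ℂ) x, σ (c x) = starRingEnd ℂ (σ x) := by
  have := algebraRat.charZero K
  have hmin : minpoly ℚ (hζ.powerBasis ℚ).gen = minpoly ℚ (hζ.inv.powerBasis ℚ).gen := by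
    rw [hζ.powerBasis_gen ℚ, hζ.inv.powerBasis_gen ℚ,
      ← hζ.minpoly_eq_cyclotomic_of_irreducible (cyclotomic.irreducible_rat (NeZero.pos i)),
      ← hζ.inv.minpoly_eq_cyclotomic_of_irreducible (cyclotomic.irreducible_rat (NeZero.pos i))]
  let c : K ≃ₐ[ℚ] K := (hζ.powerBasis ℚ).equivOfMinpoly (hζ.inv.powerBasis ℚ) hmin
  have hcζ : c ζ = ζ⁻¹ := 
    (congrArg c (hζ.powerBasis_gen ℚ).symm).trans
      ((PowerBasis.equivOfMinpoly_gen _ _ hmin).trans (hζ.inv.powerBasis_gen ℚ))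
  refine ⟨c, hcζ, fun x => ?_, fun σ x => ?_⟩
  · have : (c.trans c : K ≃ₐ[ℚ] K).toAlgHom = AlgHom.id ℚ K :=
      (hζ.powerBasis ℚ).algHom_ext (by simp [hcζ])
    exact DFunLike.congr_fun this x
  · have : σ.comp c.toAlgHom = ((starRingEnd ℂ : ℂ →+* ℂ).comp σ.toRingHom).toRatAlgHom := 
      (hζ.powerBasis ℚ).algHom_ext (by
        have h1 : (σ ζ) * starRingEnd ℂ (σ ζ) = 1 := by
          rw [Complex.mul_conj', show ‖σ ζ‖ = 1 from
            (hζ.map_of_injective (f := σ) σ.injective).norm'_eq_one (NeZero.ne i)]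
          simp
        have h2 : σ ζ⁻¹ = starRingEnd ℂ (σ ζ) := by
          rw [map_inv₀]
          exact inv_eq_of_mul_eq_one_right h1
        simpa [hcζ] using h2)
    exact DFunLike.congr_fun this x

theorem Polynomial.cyclotomic_two_mul_prime {R : Type*} [CommRing R] [IsDomain R] {p : ℕ}
    (hp : p.Prime) (hp2 : ¬ p ∣ 2) : cyclotomic (2 * p) R * (X + 1) = X ^ p + 1 := by
  have h := cyclotomic_expand_eq_cyclotomic_mul hp hp2 R
  rw [cyclotomic_two] at h
  simpa using h.symm

theorem Polynomial.cyclotomic_coeff_eval_bound {i : ℕ} (h3 : 3 ≤ i) (h11 : i ≤ 11) :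
    ((Nat.totient i : ℝ) + ((cyclotomic i ℚ).coeff (Nat.totient i - 1) : ℚ)) ^ Nat.totient i <
      (Nat.totient i : ℝ) ^ Nat.totient i * |((eval 1 (cyclotomic i ℤ) : ℤ) : ℝ)| := by
  have t : Nat.totient 3 = 2 ∧ Nat.totient 4 = 2 ∧ Nat.totient 5 = 4 ∧ Nat.totient 6 = 2 ∧
    Nat.totient 7 = 6 ∧ Nat.totient 8 = 4 ∧ Nat.totient 9 = 6 ∧ Nat.totient 10 = 4 ∧
    Nat.totient 11 = 10 := by decide
  obtain ⟨t3, t4, t5, t6, t7, t8, t9, t10, t11⟩ := t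
  have c4 : ∀ (R : Type) [CommRing R], cyclotomic 4 R = X ^ 2 + 1 := fun R _ => by
    simpa [Finset.sum_range_succ, add_comm] using
      cyclotomic_prime_pow_eq_geom_sum (R := R) (n := 1) Nat.prime_two
  have c8 : ∀ (R : Type) [CommRing R], cyclotomic 8 R = X ^ 4 + 1 := fun R _ => by
    simpa [Finset.sum_range_succ, add_comm] using
      cyclotomic_prime_pow_eq_geom_sum (R := R) (n := 2) Nat.prime_two
  have c9 : ∀ (R : Type) [CommRing R], cyclotomic 9 R = 1 + X ^ 3 + X ^ 6 := fun R _ => by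
    simpa [Finset.sum_range_succ, ← pow_mul] using
      cyclotomic_prime_pow_eq_geom_sum (R := R) (n := 1) Nat.prime_three
  have c6 : ∀ (R : Type) [CommRing R] [IsDomain R], cyclotomic 6 R = X ^ 2 - X + 1 :=
      fun R _ _ => by
    apply mul_right_cancel₀ (X_add_C_ne_zero (1 : R))
    rw [C_1, cyclotomic_two_mul_prime (p := 3) Nat.prime_three (by norm_num)]
    ring
  have c10 : ∀ (R : Type) [CommRing R] [IsDomain R],
      cyclotomic 10 R = X ^ 4 - X ^ 3 + X ^ 2 - X + 1 := fun R _ _ => by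
    apply mul_right_cancel₀ (X_add_C_ne_zero (1 : R))
    rw [C_1, cyclotomic_two_mul_prime (p := 5) Nat.prime_five (by norm_num)]
    ring
  have : Fact (Nat.Prime 5) := ⟨by norm_num⟩
  have : Fact (Nat.Prime 7) := ⟨by norm_num⟩
  have : Fact (Nat.Prime 11) := ⟨by norm_num⟩
  interval_cases i
  · rw [t3]; simp [coeff_X, coeff_one]; norm_num
  · rw [t4, c4, c4]; simp [coeff_one]
  · rw [t5, cyclotomic_prime, cyclotomic_prime]
    simp [Finset.sum_range_succ, coeff_X, coeff_one, coeff_X_pow]; norm_num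
  · rw [t6, c6, c6]; simp [coeff_X, coeff_one]; norm_num
  · rw [t7, cyclotomic_prime, cyclotomic_prime]
    simp [Finset.sum_range_succ, coeff_X, coeff_one, coeff_X_pow]; norm_num
  · rw [t8, c8, c8]; simp [coeff_one]
  · rw [t9, c9, c9]; simp [coeff_one, coeff_X_pow]
  · rw [t10, c10, c10]; simp [coeff_X, coeff_one, coeff_X_pow]; norm_num
  · rw [t11, cyclotomic_prime, cyclotomic_prime]
    simp [Finset.sum_range_succ, coeff_X, coeff_one, coeff_X_pow]; norm_num

theorem IsCyclotomicExtension.trinomial_conj_bound {K : Type*} [Field K] [Algebra ℚ K] {i : ℕ}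
    [IsCyclotomicExtension {i} ℚ K] {ζ : K} (hζ : IsPrimitiveRoot ζ i) (h2 : 2 ≤ i) (h11 : i ≤ 11)
    (c : K ≃ₐ[ℚ] K) (hcζ : c ζ = ζ⁻¹)
    (hc : ∀ (σ : K →ₐ[ℚ] ℂ) x, σ (c x) = starRingEnd ℂ (σ x)) {x y : K} (hx : IsIntegral ℤ x)
    (hy : IsIntegral ℤ y) (hxy : x * c y = ζ - 1) :
    ((Algebra.trace ℚ K (4 - ζ - c ζ) : ℚ) : ℝ) < ((Algebra.trace ℚ K (x * c x) : ℚ) : ℝ) +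
      ((Algebra.trace ℚ K (y * c y) : ℚ) : ℝ) + 2 * (Module.finrank ℚ K : ℝ) := by
  have : NeZero i := ⟨by omega⟩
  have := algebraRat.charZero K
  have : FiniteDimensional ℚ K := IsCyclotomicExtension.finiteDimensional {i} ℚ K
  have hirr : Irreducible (cyclotomic i ℚ) := cyclotomic.irreducible_rat (NeZero.pos i)
  have hfin : Module.finrank ℚ K = Nat.totient i := IsCyclotomicExtension.finrank K hirr
  have htr4 : Algebra.trace ℚ K 4 = Module.finrank ℚ K * 4 := by
    have := Algebra.trace_algebraMap (R := ℚ) (S := K) 4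
    simpa using this
  have hcsymm : Algebra.trace ℚ K (c ζ) = Algebra.trace ℚ K ζ := Algebra.trace_eq_of_algEquiv c ζ
  rcases h2.eq_or_lt with rfl | h3
  · have hζ1 : ζ = -1 := hζ.eq_neg_one_of_two_right
    rw [Nat.totient_two] at hfin
    have hbot : (⊥ : Subalgebra ℚ K) = ⊤ := Subalgebra.bot_eq_top_of_finrank_eq_one hfin
    have key : ∀ w : K, IsIntegral ℤ w → ∃ m : ℤ, w = m := fun w hw => by
      have hw' : w ∈ (⊥ : Subalgebra ℚ K) := hbot ▸ Algebra.mem_top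
      obtain ⟨r, rfl⟩ := Algebra.mem_bot.1 hw'
      have hr : IsIntegral ℤ r := (isIntegral_algebraMap_iff (algebraMap ℚ K).injective).1 hw
      obtain ⟨m, rfl⟩ := (IsIntegrallyClosed.isIntegral_iff (R := ℤ) (K := ℚ)).1 hr
      exact ⟨m, by simp⟩
    obtain ⟨a, rfl⟩ := key x hx
    obtain ⟨b, rfl⟩ := key y hy
    have hab : a * b = -2 := by
      rw [map_intCast, hζ1] at hxy
      have : ((a * b : ℤ) : K) = ((-2 : ℤ) : K) := by push_cast; rw [hxy]; norm_num
      exact_mod_cast this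
    have htri : ∀ m : ℤ, Algebra.trace ℚ K (m : K) = m := fun m => by
      have := Algebra.trace_algebraMap (R := ℚ) (S := K) (m : ℚ)
      simpa [hfin] using this
    have e1 : (4 - ζ - c ζ : K) = ((6 : ℤ) : K) := by rw [hcζ, hζ1]; push_cast; norm_num
    rw [e1, map_intCast c, map_intCast c, ← Int.cast_mul, ← Int.cast_mul, htri, htri, htri, hfin]
    have hfin' : (6 : ℤ) < a * a + b * b + 2 := by
      have h2a : a ∣ 2 := ⟨-b, by linarith⟩
      have h1 := Int.le_of_dvd two_pos h2a
      have h2 := Int.le_of_dvd two_pos (neg_dvd.2 h2a)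
      have h3 : -2 ≤ a := by linarith
      interval_cases a <;> first | omega | nlinarith
    have := (Int.cast_lt (R := ℝ)).2 hfin'
    push_cast at this ⊢
    linarith
  · have hmin : minpoly ℚ ζ = cyclotomic i ℚ := (hζ.minpoly_eq_cyclotomic_of_irreducible hirr).symm
    have htrζ : Algebra.trace ℚ K ζ = -(cyclotomic i ℚ).coeff (Nat.totient i - 1) := by
      have h := (hζ.powerBasis ℚ).trace_gen_eq_nextCoeff_minpoly
      rw [hζ.powerBasis_gen ℚ, hmin, nextCoeff_of_natDegree_pos, natDegree_cyclotomic] at h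
      · exact h
      · rw [natDegree_cyclotomic]; exact Nat.totient_pos.2 (by omega)
    have hnorm : Algebra.norm ℚ (ζ - 1) = (eval 1 (cyclotomic i ℤ) : ℤ) :=
      hζ.sub_one_norm_eq_eval_cyclotomic h3 hirr
    rw [Algebra.trace_mul_conj_eq_sum hc, Algebra.trace_mul_conj_eq_sum hc]
    have hb := cyclotomic_coeff_eval_bound h3 h11
    have := Algebra.lt_sum_sq_add_sum_sq hc (t := (Nat.totient i : ℝ) +
      ((cyclotomic i ℚ).coeff (Nat.totient i - 1) : ℚ)) (x := x) (y := y) (w := ζ - 1)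
      (by rw [hfin, hnorm]; simpa using hb) hxy
    rw [map_sub, map_sub, hcsymm, htr4, htrζ, hfin]
    push_cast
    linarith

theorem IsCyclotomicExtension.dvd_of_dvd_trinomial {K : Type*} [Field K] [Algebra ℚ K] {i : ℕ}
    [IsCyclotomicExtension {i} ℚ K] {ζ : K} (hζ : IsPrimitiveRoot ζ i) (h2 : 2 ≤ i) (h11 : i ≤ 11)
    {n : ℕ} (hn : 4 ≤ n) {u v : K[X]} (hu : ∀ j, IsIntegral ℤ (u.coeff j))
    (hv : ∀ j, IsIntegral ℤ (v.coeff j)) (huv : u * v = X ^ n - C ζ * X + C (ζ - 1)) :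
    u ∣ (X - 1) * (X + C ζ⁻¹) ∨ v ∣ (X - 1) * (X + C ζ⁻¹) := by
  have : NeZero i := ⟨by omega⟩
  have := algebraRat.charZero K
  have : FiniteDimensional ℚ K := IsCyclotomicExtension.finiteDimensional {i} ℚ K
  obtain ⟨c, hcζ, hcc, hc⟩ := IsCyclotomicExtension.exists_conj hζ
  have hz : ζ * (c : K →+* K) ζ = 1 := by
    change ζ * c ζ = 1
    rw [hcζ, mul_inv_cancel₀ (hζ.ne_zero (by omega))]
  have hz1 : ζ ≠ 1 := hζ.ne_one (by omega)
  obtain ⟨κ, h | h⟩ := conj_reciprocal_factor_of_trinomial (c : K →+* K) hcc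
    ((Rat.castHom ℝ).toAddMonoidHom.comp (Algebra.trace ℚ K).toAddMonoidHom)
    (integralClosure ℤ K).toSubring (fun x hx => IsIntegral.map (c.toAlgHom.restrictScalars ℤ) hx)
    (Module.finrank ℚ K) (by exact_mod_cast Module.finrank_pos)
    (fun x hx hx0 => by
      change _ ≤ ((Algebra.trace ℚ K (x * c x) : ℚ) : ℝ)
      rw [Algebra.trace_mul_conj_eq_sum hc]
      exact Algebra.finrank_le_sum_sq hx hx0) hz hz1
    (fun x hx y hy hxy =>
      IsCyclotomicExtension.trinomial_conj_bound hζ h2 h11 c hcζ hc hx hy hxy) hn u v hu hv huv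
  · right
    have := dvd_of_conj_reciprocal_of_dvd_trinomial (c : K →+* K) hz hz1 (by omega)
      ((mul_comm v u).trans huv) h
    rw [← hcζ]; exact this
  · left
    have := dvd_of_conj_reciprocal_of_dvd_trinomial (c : K →+* K) hz hz1 (by omega) huv h
    rw [← hcζ]; exact this

theorem Polynomial.monic_trinomial {R : Type*} [CommRing R] [Nontrivial R] (z : R) {n : ℕ}
    (hn : 2 ≤ n) :
    (X ^ n - C z * X + C (z - 1)).Monic ∧ (X ^ n - C z * X + C (z - 1)).natDegree = n := by
  have hlt : (C z * X - C (z - 1)).degree < (X ^ n : R[X]).degree := by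
    rw [degree_X_pow, sub_eq_add_neg, ← C_neg]
    exact degree_linear_le.trans_lt (by exact_mod_cast hn)
  rw [sub_add]
  exact ⟨(monic_X_pow n).sub_of_left hlt,
    (natDegree_eq_of_degree_eq (degree_sub_eq_left_of_degree_lt hlt)).trans
      (natDegree_X_pow n)⟩

theorem Polynomial.isIntegral_coeff_of_dvd_trinomial {K : Type*} [Field K] {ζ : K}
    (hζ : IsIntegral ℤ ζ) {n : ℕ} (hn : 2 ≤ n) {u : K[X]} (hu : u.Monic)
    (h : u ∣ X ^ n - C ζ * X + C (ζ - 1)) (j : ℕ) : IsIntegral ℤ (u.coeff j) := by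
  let z : integralClosure ℤ K := ⟨ζ, hζ⟩
  refine isIntegral_trans (A := integralClosure ℤ K) _
    (isIntegral_coeff_of_dvd _ u (monic_trinomial z hn).1 hu ?_ j)
  simpa [z] using h

/-- Traces of powers of a root of `1 + X + ⋯ + X ^ k = ζ`. -/
theorem IsCyclotomicExtension.trace_pow_of_geom_sum_eq {K : Type*} [Field K] [Algebra ℚ K] {i : ℕ}
    [IsCyclotomicExtension {i} ℚ K] {ζ : K} (hζ : IsPrimitiveRoot ζ i) (h2 : 2 ≤ i) (h11 : i ≤ 11)
    {E : Type*} [Field E] [Algebra K E] [FiniteDimensional K E] {x : E}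
    (hx : IntermediateField.adjoin K {x} = ⊤) {k : ℕ} (hk : 3 ≤ k)
    (hxζ : ∑ j ∈ Finset.range (k + 1), x ^ j = algebraMap K E ζ) :
    ∃ a b : ℤ, (b ≠ 0 → (-ζ⁻¹) ^ (k + 2) = 1) ∧ (Module.finrank K E : ℤ) = b - a * k ∧
      ∀ l, 0 < l → l < k → Algebra.trace K E (x ^ l) = a + b * (-ζ⁻¹) ^ l := by
  have : NeZero i := ⟨by omega⟩
  have := algebraRat.charZero K
  have : CharZero E := charZero_of_injective_algebraMap (algebraMap K E).injective
  have hζ0 : ζ ≠ 0 := hζ.ne_zero (by omega)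
  have hζi : IsIntegral ℤ ζ := hζ.isIntegral (by omega)
  have hxint : IsIntegral K x := IsIntegral.of_finite K x
  set f : K[X] := X ^ (k + 1) - C ζ * X + C (ζ - 1) with hf
  have hfm : f.Monic := (monic_trinomial ζ (by omega)).1
  have hfd : f.natDegree = k + 1 := (monic_trinomial ζ (by omega)).2
  have hx1 : x ≠ 1 := by
    rintro rfl
    simp only [one_pow, Finset.sum_const, Finset.card_range, nsmul_eq_mul, mul_one] at hxζ
    have h : ((k + 1 : ℕ) : E) ^ i = 1 := by rw [hxζ, ← map_pow, hζ.pow_eq_one, map_one]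
    have h' : (k + 1) ^ i = 1 := by exact_mod_cast h
    exact (Nat.one_lt_pow (by omega) (by omega)).ne' h'
  have hfx : aeval x f = 0 := by
    have := mul_geom_sum x (k + 1)
    rw [hxζ] at this
    simp only [hf, map_add, map_sub, map_mul, map_pow, aeval_X, aeval_C, map_one]
    linear_combination -this
  have hum := minpoly.monic hxint
  obtain ⟨v, hv⟩ := minpoly.dvd K x hfx
  have hvm : v.Monic := hum.of_mul_monic_left (hv ▸ hfm)
  have hu1 : ¬ (X - C 1) ∣ minpoly K x := fun h => hx1 <| by
    have := eq_of_monic_of_associated (monic_X_sub_C (1 : K)) hum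
      ((irreducible_X_sub_C (1 : K)).associated_of_dvd (minpoly.irreducible hxint) h)
    have h0 := minpoly.aeval K x
    rw [← this] at h0
    simpa [sub_eq_zero] using h0
  have hf1 : (X - C 1) ∣ f := by rw [dvd_iff_isRoot]; simp [hf, IsRoot]
  obtain ⟨g, hg⟩ : (X - C 1) ∣ v := by
    rw [hv] at hf1
    exact ((prime_X_sub_C (1 : K)).dvd_or_dvd hf1).resolve_left hu1
  have hgm : g.Monic := (monic_X_sub_C (1 : K)).of_mul_monic_left (hg ▸ hvm)
  have hroot : ∀ y : K, y = -ζ⁻¹ → f.IsRoot y → y ^ (k + 2) = 1 := by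
    rintro y rfl h
    simp only [hf, IsRoot, eval_add, eval_sub, eval_pow, eval_mul, eval_X, eval_C] at h
    have h' : (-ζ⁻¹) ^ (k + 1) = -ζ := by
      field_simp at h ⊢
      linear_combination h
    rw [pow_succ, h']
    field_simp
  rcases IsCyclotomicExtension.dvd_of_dvd_trinomial hζ h2 h11 (n := k + 1) (by omega)
    (isIntegral_coeff_of_dvd_trinomial hζi (by omega) hum (Dvd.intro _ hv.symm))
    (isIntegral_coeff_of_dvd_trinomial hζi (by omega) hvm (Dvd.intro_left _ hv.symm)) hv.symm
    with h | h
  · have hxy : x = algebraMap K E (-ζ⁻¹) := by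
      have := aeval_eq_zero_of_dvd_aeval_eq_zero h (minpoly.aeval K x)
      simp only [map_mul, map_sub, map_add, aeval_X, map_one, aeval_C, mul_eq_zero, sub_eq_zero,
        hx1, false_or] at this
      rw [map_neg]
      exact eq_neg_of_add_eq_zero_left this
    have hfin : Module.finrank K E = 1 := by
      rw [← IntermediateField.finrank_top', ← hx,
        IntermediateField.finrank_adjoin_simple_eq_one_iff,
        hxy]
      exact IntermediateField.algebraMap_mem _ _
    refine ⟨0, 1, fun _ => hroot _ rfl ?_, by simp [hfin], fun l _ _ => ?_⟩
    · rw [hxy, aeval_algebraMap_apply, map_eq_zero] at hfx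
      simpa [IsRoot, coe_aeval_eq_eval] using hfx
    · rw [hxy, ← map_pow, Algebra.trace_algebraMap, hfin]
      simp
  · have hgy : g ∣ X - C (-ζ⁻¹) := by
      rw [hg, ← C_1] at h
      have := (mul_dvd_mul_iff_left (X_sub_C_ne_zero (1 : K))).1 h
      simpa using this
    let pb := PowerBasis.ofAdjoinEqTop hxint (IntermediateField.adjoin_eq_top_iff.1 hx)
    have hpb : pb.gen = x := PowerBasis.ofAdjoinEqTop_gen _ _
    have hfin : Module.finrank K E = (minpoly K x).natDegree := by
      rw [pb.finrank, ← pb.natDegree_minpoly, hpb]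
    have hdeg : Module.finrank K E + (1 + g.natDegree) = k + 1 := by
      rw [hfin, ← hfd, hv, hum.natDegree_mul hvm, hg, (monic_X_sub_C (1 : K)).natDegree_mul hgm,
        natDegree_X_sub_C]
    let L := AlgebraicClosure K
    have htr : ∀ l, 0 < l → l < k → algebraMap K L (Algebra.trace K E (x ^ l)) +
        (1 + ((g.aroots L).map (· ^ l)).sum) = 0 := fun l hl hlk => by
      have h0 := sum_roots_pow_eq_zero (L := L) (f := f.map (algebraMap K L)) (hfm.map _) hl
        (by rw [natDegree_map, hfd]; omega) (fun j hj hjl => by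
          rw [natDegree_map, hfd, coeff_map]
          simp [hf, coeff_X, coeff_C, coeff_one, coeff_X_pow, show k + 1 - j ≠ k + 1 by omega,
            show 1 ≠ k + 1 - j by omega, show k + 1 - j ≠ 0 by omega])
      have ht := pb.trace_aeval_gen_eq_sum_aroots L (X ^ l)
      simp only [hpb, map_pow, aeval_X] at ht
      rw [ht, ← h0]
      change _ = ((f.aroots L).map _).sum
      rw [hv, aroots_mul (hv ▸ hfm.ne_zero), hg, aroots_mul (hg ▸ hvm.ne_zero), aroots_X_sub_C]
      simp [add_left_comm]
    rcases (irreducible_X_sub_C (-ζ⁻¹)).dvd_iff.1 hgy with h1 | h1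
    · have hg1 : g = 1 := hgm.eq_one_of_isUnit h1
      subst hg1
      refine ⟨-1, 0, fun h => absurd rfl h, ?_, fun l hl hlk => ?_⟩
      · simp at hdeg ⊢; omega
      · apply (algebraMap K L).injective
        have := htr l hl hlk
        simp at this ⊢
        linear_combination this
    · have hg1 : g = X - C (-ζ⁻¹) := eq_of_monic_of_associated hgm (monic_X_sub_C _) h1.symm
      refine ⟨-1, -1, fun _ => hroot _ rfl ?_, ?_, fun l hl hlk => ?_⟩
      · rw [← dvd_iff_isRoot, ← hg1, hv, hg]
        exact Dvd.intro_left _ (mul_assoc _ _ _)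
      · rw [hg1, natDegree_X_sub_C] at hdeg; omega
      · apply (algebraMap K L).injective
        have := htr l hl hlk
        rw [hg1, aroots_X_sub_C] at this
        simp at this ⊢
        linear_combination this

theorem Algebra.trace_eq_of_minpoly_eq {F E : Type*} [Field F] [Field E] [Algebra F E] [CharZero F]
    [FiniteDimensional F E] {x y : E} (h : minpoly F x = minpoly F y) :
    Algebra.trace F E x = Algebra.trace F E y := by
  have key : ∀ z : E, (minpoly F z).natDegree *
      Module.finrank (IntermediateField.adjoin F {z}) E = Module.finrank F E := fun z => by
    rw [← IntermediateField.adjoin.finrank (Algebra.IsIntegral.isIntegral (R := F) z),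
      Module.finrank_mul_finrank]
  have h0 : (minpoly F y).natDegree ≠ 0 :=
    (minpoly.natDegree_pos (Algebra.IsIntegral.isIntegral (R := F) y)).ne'
  have h1 := (key x).trans (key y).symm
  rw [h] at h1
  rw [trace_eq_finrank_mul_minpoly_nextCoeff, trace_eq_finrank_mul_minpoly_nextCoeff, h,
    Nat.eq_of_mul_eq_mul_left (Nat.pos_of_ne_zero h0) h1]

theorem Algebra.trace_pow_eq_of_coprime_orderOf {E : Type*} [Field E] [Algebra ℚ E]
    [FiniteDimensional ℚ E] {y : E} {n l : ℕ} (hn : n ≠ 0) (hy : y ^ n = 1)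
    (hl : l.Coprime (orderOf y)) : Algebra.trace ℚ E (y ^ l) = Algebra.trace ℚ E y := by
  have := algebraRat.charZero E
  have hi : IsIntegral ℤ y := (IsPrimitiveRoot.orderOf y).isIntegral
    (orderOf_pos_iff.2 (isOfFinOrder_iff_pow_eq_one.2 ⟨n, Nat.pos_of_ne_zero hn, hy⟩))
  apply Algebra.trace_eq_of_minpoly_eq
  rw [minpoly.isIntegrallyClosed_eq_field_fractions' ℚ hi,
    minpoly.isIntegrallyClosed_eq_field_fractions' ℚ (hi.pow l),
    ← (IsPrimitiveRoot.orderOf y).minpoly_eq_pow_coprime hl]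

theorem Algebra.exists_trace_pow_of_geom_sum_eq {E : Type u} [Field E] [Algebra ℚ E]
    [FiniteDimensional ℚ E] {i : ℕ} {ζ : E} (hζ : IsPrimitiveRoot ζ i) (h2 : 2 ≤ i) (h11 : i ≤ 11)
    {x : E} (hx : IntermediateField.adjoin ℚ {x} = ⊤) {k : ℕ} (hk : 3 ≤ k)
    (hxζ : ∑ j ∈ Finset.range (k + 1), x ^ j = ζ) :
    ∃ (K : Type u) (_ : Field K) (_ : Algebra ℚ K) (_ : Algebra K E) (_ : IsScalarTower ℚ K E)
      (_ : FiniteDimensional ℚ K) (_ : FiniteDimensional K E),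
      IsCyclotomicExtension {i} ℚ K ∧ ∃ z : K, IsPrimitiveRoot z i ∧
      algebraMap K E z = ζ ∧
      ∃ a b : ℤ, (b ≠ 0 → (-z⁻¹) ^ (k + 2) = 1) ∧ (Module.finrank K E : ℤ) = b - a * k ∧
        ∀ l, 0 < l → l < k → Algebra.trace K E (x ^ l) = a + b * (-z⁻¹) ^ l := by
  have : NeZero i := ⟨by omega⟩
  let K : IntermediateField ℚ E := IntermediateField.adjoin ℚ {ζ}
  have hK : @IsCyclotomicExtension {i} ℚ K _ _ K.algebra' :=
    hζ.intermediateField_adjoin_isCyclotomicExtension ℚ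
  let z : K := IntermediateField.AdjoinSimple.gen ℚ ζ
  have hz : IsPrimitiveRoot z i :=
    IsPrimitiveRoot.of_map_of_injective (f := algebraMap K E) hζ (algebraMap K E).injective
  exact ⟨K, inferInstance, K.algebra', inferInstance, inferInstance, inferInstance, inferInstance,
    hK, z, hz, rfl, @IsCyclotomicExtension.trace_pow_of_geom_sum_eq K _ K.algebra' i hK z hz h2 h11
      E _ _ _ x
    (IntermediateField.adjoin_eq_top_of_adjoin_eq_top ℚ hx) k hk hxζ⟩

/-- A root `x` of `(1 + X + ⋯ + X ^ k) ^ m = 1` has the same trace as `x ^ l`. -/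
theorem Algebra.trace_pow_eq_of_geom_sum_pow_eq_one {E : Type*} [Field E] [Algebra ℚ E]
    [FiniteDimensional ℚ E] {m : ℕ} (hm : m ≠ 0) (h11 : m ≤ 11) {x : E}
    (hx : IntermediateField.adjoin ℚ {x} = ⊤) {k : ℕ} (hk : 3 ≤ k)
    (hxm : (∑ j ∈ Finset.range (k + 1), x ^ j) ^ m = 1) {l : ℕ} (hl : 0 < l) (hlk : l < k)
    (h1 : l.Coprime k) (h2 : l.Coprime ((k + 2).gcd (2 * m))) :
    Algebra.trace ℚ E (x ^ l) = Algebra.trace ℚ E x := by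
  have := algebraRat.charZero E
  set ζ := ∑ j ∈ Finset.range (k + 1), x ^ j with hζ
  have hdvd : orderOf ζ ∣ m := orderOf_dvd_of_pow_eq_one hxm
  have hi11 : orderOf ζ ≤ 11 := (Nat.le_of_dvd (Nat.pos_of_ne_zero hm) hdvd).trans h11
  have hi0 : orderOf ζ ≠ 0 := fun h => hm (by simpa [h] using hdvd)
  have hprim := IsPrimitiveRoot.orderOf ζ
  by_cases h1' : orderOf ζ = 1
  · rw [orderOf_eq_one_iff] at h1'
    rw [hζ, Finset.sum_range_succ', pow_zero, add_eq_right] at h1'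
    simp_rw [pow_succ] at h1'
    rw [← Finset.sum_mul, mul_eq_zero] at h1'
    rcases h1' with h | rfl
    · have hxk : x ^ k = 1 := by
        have := mul_geom_sum x k
        rw [h, mul_zero] at this
        exact (sub_eq_zero.1 this.symm)
      exact Algebra.trace_pow_eq_of_coprime_orderOf (by omega) hxk
        (h1.coprime_dvd_right (orderOf_dvd_of_pow_eq_one hxk))
    · rw [zero_pow hl.ne']
  · obtain ⟨K, _, _, _, _, _, _, hK, z, hz, hzζ, a, b, hb, -, htr⟩ :=
      Algebra.exists_trace_pow_of_geom_sum_eq hprim (by omega) hi11 hx hk rfl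
    have htr1 := htr 1 one_pos (by omega)
    rw [pow_one, pow_one] at htr1
    rw [← Algebra.trace_trace (S := K), ← Algebra.trace_trace (S := K) x, htr l hl hlk, htr1,
      map_add, map_add]
    congr 1
    rcases eq_or_ne b 0 with rfl | hb0
    · simp
    · have hzm : z ^ m = 1 := by
        obtain ⟨t, rfl⟩ := hdvd
        rw [pow_mul, hz.pow_eq_one, one_pow]
      have hy : (-z⁻¹) ^ (2 * m) = 1 := by
        rw [pow_mul, neg_sq, ← pow_mul, mul_comm, pow_mul, inv_pow, hzm]; simp
      have := Algebra.trace_pow_eq_of_coprime_orderOf (by omega) hy (l := l)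
        (h2.coprime_dvd_right (Nat.dvd_gcd (orderOf_dvd_of_pow_eq_one (hb hb0))
          (orderOf_dvd_of_pow_eq_one hy)))
      rw [← zsmul_eq_mul, ← zsmul_eq_mul, map_zsmul, map_zsmul, this]

theorem Algebra.trace_eq_zero_of_geom_sum_pow_six_eq_one {E : Type*} [Field E] [Algebra ℚ E]
    [FiniteDimensional ℚ E] {x ζ : E} (hx : IntermediateField.adjoin ℚ {x} = ⊤)
    (hζ : ∑ j ∈ Finset.range 5, x ^ j = ζ) (hζ6 : ζ ^ 6 = 1) :
    Algebra.trace ℚ E (x - x ^ 3 - x * ζ ^ 2 + x * ζ ^ 4) = 0 := by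
  have hdvd : orderOf ζ ∣ 6 := orderOf_dvd_of_pow_eq_one hζ6
  have hi11 : orderOf ζ ≤ 6 := Nat.le_of_dvd (by norm_num) hdvd
  have hi0 : orderOf ζ ≠ 0 := fun h => by simp [h] at hdvd
  have hprim := IsPrimitiveRoot.orderOf ζ
  by_cases h1' : orderOf ζ = 1
  · rw [orderOf_eq_one_iff] at h1'
    have := Algebra.trace_pow_eq_of_geom_sum_pow_eq_one (m := 1) (k := 4) (l := 3) one_ne_zero
      (by norm_num) hx (by norm_num) (by rw [hζ, h1', one_pow]) (by norm_num) (by norm_num)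
      (by norm_num) (by norm_num)
    rw [h1', one_pow, one_pow, mul_one, sub_add_cancel, map_sub, this, sub_self]
  · obtain ⟨K, _, _, _, _, _, _, hK, z, hz, hzζ, a, b, -, -, htr⟩ :=
      Algebra.exists_trace_pow_of_geom_sum_eq hprim (by omega) (by omega) hx
        (k := 4) (by norm_num) hζ
    have : NeZero (orderOf ζ) := ⟨hi0⟩
    have htr1 := htr 1 one_pos (by norm_num)
    have htr3 := htr 3 (by norm_num) (by norm_num)
    rw [pow_one, pow_one] at htr1
    have hz6 : z ^ 6 = 1 := (algebraMap K E).injective (by rw [map_pow, hzζ, hζ6, map_one])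
    have hz0 : z ≠ 0 := hz.ne_zero hi0
    obtain ⟨c, hcz, -, -⟩ := IsCyclotomicExtension.exists_conj hz
    have e : x - x ^ 3 - x * ζ ^ 2 + x * ζ ^ 4 = x - x ^ 3 - z ^ 2 • x + z ^ 4 • x := by
      rw [Algebra.smul_def, Algebra.smul_def, map_pow, map_pow, hzζ]
      ring
    have h5 : z⁻¹ = z ^ 5 := inv_eq_of_mul_eq_one_right (by rw [← pow_succ', hz6])
    have t1 : Algebra.trace ℚ K (z ^ 5) = Algebra.trace ℚ K z := by
      rw [← h5, ← hcz, Algebra.trace_eq_of_algEquiv]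
    have t2 : Algebra.trace ℚ K (z ^ 4) = Algebra.trace ℚ K (z ^ 2) := by
      have : z ^ 4 = c (z ^ 2) := by
        rw [map_pow, hcz, h5, ← pow_mul, show 5 * 2 = 6 + 4 by norm_num, pow_add, hz6, one_mul]
      rw [this, Algebra.trace_eq_of_algEquiv]
    rw [← Algebra.trace_trace (S := K), e, map_add, map_sub, map_sub, map_smul, map_smul, htr1,
      htr3, h5]
    have : (a : K) + b * -z ^ 5 - (a + b * (-z ^ 5) ^ 3) - z ^ 2 • (a + b * -z ^ 5) +
        z ^ 4 • (a + b * -z ^ 5) = a • (z ^ 4 - z ^ 2) + b • (z - z ^ 5) := by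
      simp only [zsmul_eq_mul, smul_eq_mul]
      linear_combination (b * z ^ 9 + b * z ^ 3 + b * z - b * z ^ 3 : K) * hz6
    rw [this, map_add, map_zsmul, map_zsmul, map_sub, map_sub, t1, t2]
    simp

theorem Algebra.trace_eq_zero_of_geom_sum_pow_nine_eq_one {E : Type*} [Field E] [Algebra ℚ E]
    [FiniteDimensional ℚ E] {x ζ : E} (hx : IntermediateField.adjoin ℚ {x} = ⊤)
    (hζ : ∑ j ∈ Finset.range 5, x ^ j = ζ) (hζ9 : ζ ^ 9 = 1) :
    Algebra.trace ℚ E ((1 + 4 * x) * (ζ ^ 3 - 1)) = 0 := by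
  by_cases h3 : ζ ^ 3 = 1
  · simp [h3]
  have hprim : IsPrimitiveRoot ζ 9 := by
    have h := orderOf_eq_prime_pow (p := 3) (n := 1) (x := ζ) (by simpa using h3)
      (by simpa using hζ9)
    rw [← show orderOf ζ = 9 by simpa using h]
    exact IsPrimitiveRoot.orderOf ζ
  obtain ⟨K, _, _, _, _, _, _, hK, z, hz, hzζ, a, b, hb, hfin, htr⟩ :=
    Algebra.exists_trace_pow_of_geom_sum_eq hprim (by omega) (by omega) hx
      (k := 4) (by norm_num) hζ
  have htr1 := htr 1 one_pos (by norm_num)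
  have hb0 : b = 0 := by
    by_contra h
    have h6 : z ^ 6 = 1 := by
      have := hb h
      rwa [Even.neg_pow (by decide), inv_pow, inv_eq_one] at this
    have := hz.dvd_of_pow_eq_one _ h6
    omega
  subst hb0
  rw [pow_one, pow_one] at htr1
  have e : (1 + 4 * x) * (ζ ^ 3 - 1) = (z ^ 3 - 1) • (algebraMap K E 1 + (4 : K) • x) := by
    rw [Algebra.smul_def, Algebra.smul_def, map_sub, map_pow, hzζ, map_one, map_ofNat]
    ring
  have hfin' : ((Module.finrank K E : ℤ) : K) = ((0 - a * (4 : ℕ) : ℤ) : K) := congrArg _ hfin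
  rw [← Algebra.trace_trace (S := K), e, map_smul (Algebra.trace K E), map_add,
    map_smul (Algebra.trace K E), htr1, Algebra.trace_algebraMap]
  push_cast at hfin'
  rw [nsmul_eq_mul, hfin']
  simp
  ring_nf
  simp

theorem Nat.exists_coprime_of_two_lt {k m : ℕ} (hk : 2 < k) (hm : m ≠ 0) (hm11 : m ≤ 11)
    (h : ¬ (k = 4 ∧ 3 ∣ m)) :
    ∃ l, 1 < l ∧ l < k ∧ l.Coprime k ∧ l.Coprime ((k + 2).gcd (2 * m)) := by
  rcases Nat.even_or_odd k with he | ho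
  · by_cases h3 : 3 ∣ k - 1 ∧ 3 ∣ m
    · have hk10 : 10 ≤ k := by
        obtain ⟨t, rfl⟩ := he
        omega
      refine ⟨k - 3, by omega, by omega, ?_, ?_⟩
      · rw [Nat.coprime_iff_gcd_eq_one]
        have h1 := Nat.gcd_dvd_left (k - 3) k
        have h2 := Nat.gcd_dvd_right (k - 3) k
        have h4 : (k - 3).gcd k ∣ 3 := by
          have := Nat.dvd_sub h2 h1
          rwa [show k - (k - 3) = 3 by omega] at this
        refine ((Nat.dvd_prime Nat.prime_three).1 h4).resolve_right fun h => ?_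
        rw [h] at h2
        omega
      · rw [Nat.coprime_iff_gcd_eq_one]
        set g := (k - 3).gcd ((k + 2).gcd (2 * m)) with hg
        have h1 : g ∣ k - 3 := Nat.gcd_dvd_left _ _
        have h2 : g ∣ k + 2 := (Nat.gcd_dvd_right _ _).trans (Nat.gcd_dvd_left _ _)
        have h5 : g ∣ 2 * m := (Nat.gcd_dvd_right _ _).trans (Nat.gcd_dvd_right _ _)
        have h4 : g ∣ 5 := by
          have := Nat.dvd_sub h2 h1
          rwa [show k + 2 - (k - 3) = 5 by omega] at this
        refine ((Nat.dvd_prime Nat.prime_five).1 h4).resolve_right fun h => ?_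
        rw [h] at h5
        omega
    · refine ⟨k - 1, by omega, by omega, ?_, ?_⟩
      · rw [Nat.coprime_self_sub_left (by omega)]
        exact Nat.coprime_one_left k
      · rw [Nat.coprime_iff_gcd_eq_one]
        set g := (k - 1).gcd ((k + 2).gcd (2 * m)) with hg
        have h1 : g ∣ k - 1 := Nat.gcd_dvd_left _ _
        have h2 : g ∣ k + 2 := (Nat.gcd_dvd_right _ _).trans (Nat.gcd_dvd_left _ _)
        have h5 : g ∣ 2 * m := (Nat.gcd_dvd_right _ _).trans (Nat.gcd_dvd_right _ _)
        have h4 : g ∣ 3 := by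
          have := Nat.dvd_sub h2 h1
          rwa [show k + 2 - (k - 1) = 3 by omega] at this
        refine ((Nat.dvd_prime Nat.prime_three).1 h4).resolve_right fun h => h3 ?_
        rw [h] at h5 h1
        omega
  · refine ⟨2, by omega, hk, ?_, ?_⟩
    · exact Nat.coprime_two_left.2 ho
    · refine Nat.Coprime.coprime_dvd_right (Nat.gcd_dvd_left _ _) ?_
      exact Nat.coprime_two_left.2 (by simpa [Nat.odd_add] using ho)

/-- The spectral obstruction. -/
theorem Matrix.not_geom_sum_eq_of_trace {n : Type*} [Fintype n] [DecidableEq n]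
    {B P : Matrix n n ℚ} {k m : ℕ} (hk : 2 < k) (hm : m ≠ 0) (hm11 : m ≤ 11)
    (hB : ∑ j ∈ Finset.range (k + 1), B ^ j = P) (hP : P ^ m = 1) {d : ℚ} (hd : 1 < d)
    (htr : ∀ l, 0 < l → l < k → (B ^ l).trace = -d ^ l)
    (h6 : k = 4 → P ^ 6 = 1 → (B * P ^ 2).trace = -d ∧ (B * P ^ 4).trace = -d)
    (h9 : k = 4 → P ^ 9 = 1 → (B * P ^ 3).trace = -d)
    (hfix : (P ^ 3).trace = Fintype.card n → P ^ 3 = 1) : False := by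
  have key : ∀ s : ℕ, P ^ s = 1 → ∀ q : ℚ[X],
      (∀ (E : Type) [Field E] [Algebra ℚ E] [FiniteDimensional ℚ E] (x : E),
        IntermediateField.adjoin ℚ {x} = ⊤ → (∑ j ∈ Finset.range (k + 1), x ^ j) ^ s = 1 →
          Algebra.trace ℚ E (aeval x q) = 0) → (aeval B q).trace = 0 := fun s hs q hq => by
    refine Matrix.trace_aeval_eq_zero B ((∑ j ∈ Finset.range (k + 1), X ^ j) ^ s - 1) q
      (by simp [hB, hs]) fun E _ _ _ x hx hxw => hq E x hx ?_
    simpa [sub_eq_zero] using hxw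
  have htr1 := htr 1 one_pos (by omega)
  rw [pow_one, pow_one] at htr1
  have hpow : ∀ l, 1 < l → d < d ^ l := fun l hl => lt_self_pow₀ hd hl
  have h6' : k = 4 → P ^ 6 ≠ 1 := by
    rintro rfl hP6
    have := key 6 hP6 (X - X ^ 3 - X * (∑ j ∈ Finset.range 5, X ^ j) ^ 2 +
      X * (∑ j ∈ Finset.range 5, X ^ j) ^ 4) fun E _ _ _ x hx hxm => by
        simpa using Algebra.trace_eq_zero_of_geom_sum_pow_six_eq_one hx rfl hxm
    simp only [map_add, map_sub, map_mul, map_pow, map_sum, aeval_X, hB, Matrix.trace_add,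
      Matrix.trace_sub, htr1, htr 3 (by norm_num) (by norm_num), h6 rfl hP6] at this
    have := hpow 3 (by norm_num)
    linarith
  by_cases h : k = 4 ∧ 3 ∣ m
  · obtain ⟨rfl, t, rfl⟩ := h
    have ht : t = 1 ∨ t = 2 ∨ t = 3 := by omega
    rcases ht with rfl | rfl | rfl
    · exact h6' rfl (by rw [show 6 = 3 * 1 * 2 by norm_num, pow_mul, hP, one_pow])
    · exact h6' rfl hP
    · have := key 9 hP ((1 + C 4 * X) * ((∑ j ∈ Finset.range 5, X ^ j) ^ 3 - 1))
        fun E _ _ _ x hx hxm => by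
          simpa using Algebra.trace_eq_zero_of_geom_sum_pow_nine_eq_one hx rfl hxm
      have e : aeval B ((1 + C 4 * X) * ((∑ j ∈ Finset.range 5, X ^ j) ^ 3 - 1) : ℚ[X]) =
          P ^ 3 - 1 + (4 : ℚ) • (B * P ^ 3) - (4 : ℚ) • B := by
        simp only [map_add, map_sub, map_mul, map_pow, map_sum, aeval_X, hB, aeval_C, map_one,
          Algebra.algebraMap_eq_smul_one, smul_mul_assoc, one_mul, add_mul, mul_sub, mul_one]
        abel
      rw [e, Matrix.trace_sub, Matrix.trace_add, Matrix.trace_sub, Matrix.trace_smul,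
        Matrix.trace_smul, htr1, h9 rfl hP, Matrix.trace_one] at this
      refine h6' rfl ?_
      rw [show 6 = 3 * 2 by norm_num, pow_mul, hfix (by linarith), one_pow]
  · obtain ⟨l, hl1, hlk, hc1, hc2⟩ := Nat.exists_coprime_of_two_lt hk hm hm11 h
    have := key m hP (X - X ^ l) fun E _ _ _ x hx hxm => by
      rw [map_sub, map_pow, aeval_X, map_sub, Algebra.trace_pow_eq_of_geom_sum_pow_eq_one hm hm11
        hx hk hxm (by omega) hlk hc1 hc2, sub_self]
    rw [map_sub, map_pow, aeval_X, Matrix.trace_sub, htr1, htr l (by omega) hlk] at this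
    have := hpow l hl1
    linarith

section

variable {F : Type*} [Fintype F] [DecidableEq F]

theorem Matrix.graph_pow_apply (ρ : Equiv.Perm F) (j : ℕ) (u v : F) :
    ((Matrix.of fun u v => if v = ρ u then (1 : ℚ) else 0) ^ j) u v =
      if v = (ρ ^ j) u then 1 else 0 := by
  induction j generalizing u with
  | zero => simp [Matrix.one_apply, eq_comm]
  | succ j ih =>
    rw [pow_succ', Matrix.mul_apply, Finset.sum_eq_single (ρ u) (by simp +contextual) (by simp)]
    simp [ih, pow_succ (a := ρ)]

theorem Matrix.not_quasi_moore {A : Matrix F F ℚ} {ρ : Equiv.Perm F} {ε : F → ℚ} {k m : ℕ}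
    (hk : 2 < k) (hm : m ≠ 0) (hm11 : m ≤ 11) (hρm : ρ ^ m = 1)
    (hS : ∀ u w, (∑ j ∈ Finset.range (k + 1), A ^ j) u w = if w = ρ u then 1 + ε u else 1)
    (hA01 : ∀ u v, A u v = 0 ∨ A u v = 1) (hAρ : ∀ u v, A (ρ u) (ρ v) = A u v)
    (hcyc : ∀ j, 0 < j → j < k → ∀ u, (A ^ j) u u = 0) {v₀ : F} (hv₀ : ε v₀ = 1)
    (hreach : ∀ w, Relation.ReflTransGen (fun u v => A u v = 1) v₀ w) (hdeg : 1 < ∑ v, A v₀ v)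
    (h3 : k = 4 → ∀ j, ρ ^ (3 * j) = 1 → ∀ u, A ((ρ ^ j) u) u = 0) : False := by
  have hloop : ∀ u, A u u = 0 := fun u => by simpa using hcyc 1 one_pos (by omega) u
  have hAnn : ∀ u v, 0 ≤ A u v := fun u v => by rcases hA01 u v with h | h <;> simp [h]
  have hdi : ∀ u v, A u v = 1 → A v u = 0 := fun u v h => by
    have := hcyc 2 two_pos hk u
    rw [pow_two, Matrix.mul_apply,
      Finset.sum_eq_zero_iff_of_nonneg fun x _ => mul_nonneg (hAnn _ _) (hAnn _ _)] at this
    simpa [h] using this v (Finset.mem_univ v)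
  set S := ∑ j ∈ Finset.range (k + 1), A ^ j with hSdef
  have hcomm : A * S = S * A := by
    rw [hSdef, Finset.mul_sum, Finset.sum_mul]
    exact Finset.sum_congr rfl fun j _ => (pow_succ' A j).symm.trans (pow_succ A j)
  have hS' : ∀ u w, S u w = 1 + if w = ρ u then ε u else 0 := fun u w => by
    rw [hS]; split_ifs <;> simp
  have hrel : ∀ u z, ∑ x, A u x + A u z * ε z = ∑ x, A x (ρ z) + ε u * A u z := fun u z => by
    have h := congrFun (congrFun hcomm u) (ρ z)
    simp only [Matrix.mul_apply, hS', mul_add, add_mul, mul_one, one_mul,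
      Finset.sum_add_distrib, mul_ite, ite_mul, mul_zero, zero_mul, EmbeddingLike.apply_eq_iff_eq,
      Finset.sum_ite_eq, Finset.sum_ite_eq', Finset.mem_univ, if_true, hAρ] at h
    exact h
  have hio : ∀ u, ∑ x, A x (ρ u) = ∑ x, A u x := fun u => by
    have := hrel u u
    rw [hloop] at this
    linarith
  have hadj : ∀ u z, A u z = 1 → ε z = ε u := fun u z h => by
    have h1 := hrel u z
    have h2 := hrel z u
    rw [hio] at h1 h2
    rw [hdi u z h] at h2
    rw [h] at h1
    linarith
  have hε : ∀ w, ε w = 1 := fun w => by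
    induction hreach w with
    | refl => exact hv₀
    | tail _ h ih => rw [hadj _ _ h, ih]
  set d := ∑ v, A v₀ v with hd
  have hout : ∀ u, ∑ x, A u x = d := fun u => by
    have h := hrel u v₀
    rw [hio, hε, hε] at h
    linarith
  have hin : ∀ u, ∑ x, A x u = d := fun u => by
    rw [← ρ.apply_symm_apply u, hio, hout]
  set P : Matrix F F ℚ := Matrix.of fun u v => if v = ρ u then (1 : ℚ) else 0 with hP
  have hN : (Fintype.card F : ℚ) ≠ 0 := by
    have : Nonempty F := ⟨v₀⟩
    exact_mod_cast Fintype.card_ne_zero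
  set E : Matrix F F ℚ := Matrix.of fun _ _ => (Fintype.card F : ℚ)⁻¹ with hE
  have hEE : E * E = E := by
    ext u v
    simp [hE, Matrix.mul_apply, hN]
  have hAE : A * E = d • E := by
    ext u v
    simp [hE, Matrix.mul_apply, ← Finset.sum_mul, hout]
  have hEA : E * A = d • E := by
    ext u v
    simp only [hE, Matrix.mul_apply, Matrix.of_apply, ← Finset.mul_sum, hin, Matrix.smul_apply,
      smul_eq_mul]
    exact mul_comm _ _
  have hpowE : ∀ j, A ^ j * E = d ^ j • E := fun j => by
    induction j with
    | zero => simp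
    | succ j ih => rw [pow_succ', mul_assoc, ih, mul_smul_comm, hAE, smul_smul, pow_succ]
  have hpowB : ∀ j, 0 < j → (A - d • E) ^ j = A ^ j - d ^ j • E := fun j hj => by
    induction j, hj using Nat.le_induction with
    | base => simp
    | succ j hj ih =>
      rw [pow_succ, ih, sub_mul, mul_sub, mul_sub, mul_smul_comm, hpowE, smul_mul_assoc, hEA,
        smul_mul_assoc, mul_smul_comm, hEE, ← pow_succ, smul_smul, smul_smul, ← pow_succ,
        ← pow_succ']
      abel
  have hSE : S = (Fintype.card F : ℚ) • E + P := by
    ext u w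
    rw [hS']
    simp [hE, hP, hN, hε]
  have hPE : ∀ j, E * P ^ j = E := fun j => by
    ext u v
    rw [Matrix.mul_apply]
    simp only [hP, Matrix.graph_pow_apply]
    simp [hE, ← Equiv.symm_apply_eq]
  have hPE' : P * E = E := by
    ext u v
    simp [hP, hE, Matrix.mul_apply]
  have htrE : E.trace = 1 := by simp [hE, Matrix.trace, hN]
  have hPρ : ∀ j, P ^ j = 1 ↔ ρ ^ j = 1 := fun j => by
    constructor
    · intro h
      ext u
      have := congrFun (congrFun h u) ((ρ ^ j) u)
      rw [hP, Matrix.graph_pow_apply, if_pos rfl, Matrix.one_apply] at this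
      by_contra hne
      rw [if_neg fun h => hne h.symm] at this
      exact one_ne_zero this
    · intro h
      ext u v
      rw [hP, Matrix.graph_pow_apply, h, Matrix.one_apply, Equiv.Perm.one_apply]
      simp [eq_comm]
  have htrP : k = 4 → ∀ j, ρ ^ (3 * j) = 1 → ((A - d • E) * P ^ j).trace = -d := by
    intro hk4 j hj
    have h0 : (A * P ^ j).trace = 0 := by
      rw [Matrix.trace_mul_comm]
      simp only [Matrix.trace, Matrix.diag, Matrix.mul_apply, hP, Matrix.graph_pow_apply]
      simp [h3 hk4 j hj]
    rw [sub_mul, smul_mul_assoc, hPE, Matrix.trace_sub, Matrix.trace_smul, htrE, h0]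
    simp
  have hsum : ∑ j ∈ Finset.range (k + 1), d ^ j = Fintype.card F + 1 := by
    have h : S * E = (∑ j ∈ Finset.range (k + 1), d ^ j) • E := by
      rw [hSdef, Finset.sum_mul, Finset.sum_smul]
      exact Finset.sum_congr rfl fun j _ => hpowE j
    rw [hSE, add_mul, smul_mul_assoc, hEE, hPE'] at h
    have h' := congrFun (congrFun h v₀) v₀
    simp only [hE, Matrix.add_apply, Matrix.smul_apply, Matrix.of_apply, smul_eq_mul] at h'
    field_simp at h'
    linarith
  refine Matrix.not_geom_sum_eq_of_trace (B := A - d • E) (P := P) hk hm hm11 ?_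
    ((hPρ m).2 hρm) hdeg ?_ ?_ ?_ ?_
  · rw [Finset.sum_range_succ', Finset.sum_congr rfl fun j _ => hpowB (j + 1) j.succ_pos,
      Finset.sum_sub_distrib, ← Finset.sum_smul]
    rw [Finset.sum_range_succ'] at hsum hSdef
    rw [← eq_sub_iff_add_eq] at hsum
    rw [hsum, pow_zero (A - d • E), pow_zero d, sub_add_eq_add_sub, ← pow_zero A, ← hSdef, hSE]
    simp
  · intro l hl hlk
    rw [hpowB l hl, Matrix.trace_sub, Matrix.trace_smul, htrE]
    simp [Matrix.trace, hcyc l hl hlk]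
  · intro hk4 h6
    have h6 := (hPρ 6).1 h6
    exact ⟨htrP hk4 2 h6, htrP hk4 4 (by rw [show 3 * 4 = 6 * 2 from rfl, pow_mul, h6, one_pow])⟩
  · exact fun hk4 h9 => htrP hk4 3 ((hPρ 9).1 h9)
  · intro h
    rw [hPρ]
    ext u
    simp only [Matrix.trace, Matrix.diag, hP, Matrix.graph_pow_apply] at h
    rw [Finset.sum_boole, Nat.cast_inj, ← Finset.card_univ, Finset.card_filter_eq_iff] at h
    exact (h u (Finset.mem_univ u)).symm

end

end

section

variable {V : Type} {R : V → V → Prop} {u v w : V} {l : List V}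

theorem isWalkFrom_nil : IsWalkFrom R u v [] ↔ u = v := by
  exact ⟨fun h => h.2, fun h => ⟨List.isChain_singleton _, h⟩⟩

theorem isWalkFrom_cons : IsWalkFrom R u v (w :: l) ↔ R u w ∧ IsWalkFrom R w v l := by
  exact ⟨fun h => ⟨(List.isChain_cons_cons.1 h.1).1, (List.isChain_cons_cons.1 h.1).2, h.2⟩,
    fun h => ⟨List.isChain_cons_cons.2 ⟨h.1, h.2.1⟩, h.2.2⟩⟩

theorem isWalkFrom_map {V' : Type} (f : V → V') (hf : Function.Injective f)
    {R' : V' → V' → Prop} (hR : ∀ a b, R' (f a) (f b) ↔ R a b) :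
    IsWalkFrom R' (f u) (f v) (l.map f) ↔ IsWalkFrom R u v l := by
  induction l generalizing u with
  | nil => simp [isWalkFrom_nil, hf.eq_iff]
  | cons w l ih => rw [List.map_cons, isWalkFrom_cons, isWalkFrom_cons, hR, ih]

theorem IsWalkFrom.reflTransGen (h : IsWalkFrom R u v l) : Relation.ReflTransGen R u v := by
  induction l generalizing u with
  | nil => rw [isWalkFrom_nil.1 h]
  | cons w l ih =>
    rw [isWalkFrom_cons] at h
    exact .head h.1 (ih h.2)

variable [Fintype V] [DecidableEq V] [DecidableRel R]

variable (R) in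
/-- The walks from `u` to `v` of length exactly `j`, written without their first vertex. -/
def walksOfLength : ℕ → V → V → Finset (List V)
  | 0, u, v => if u = v then {[]} else ∅
  | j + 1, u, v => (Finset.univ.filter (R u)).biUnion fun w =>
      (walksOfLength j w v).image (List.cons w)

theorem mem_walksOfLength {j : ℕ} :
    l ∈ walksOfLength R j u v ↔ IsWalkFrom R u v l ∧ l.length = j := by
  induction j generalizing u l with
  | zero =>
    rw [walksOfLength, List.length_eq_zero_iff]
    split_ifs with h
    · simp +contextual [h, isWalkFrom_nil]
    · simp only [Finset.notMem_empty, false_iff]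
      rintro ⟨h', rfl⟩
      exact h (isWalkFrom_nil.1 h')
  | succ j ih =>
    simp only [walksOfLength, Finset.mem_biUnion, Finset.mem_filter, Finset.mem_univ, true_and,
      Finset.mem_image, ih]
    cases l with
    | nil => simp
    | cons w l => simp [isWalkFrom_cons, and_assoc]

theorem adjMatrix_pow_apply (j : ℕ) :
    ((Matrix.of fun u v => if R u v then (1 : ℚ) else 0) ^ j) u v =
      (walksOfLength R j u v).card := by
  induction j generalizing u with
  | zero =>
    rw [pow_zero, Matrix.one_apply, walksOfLength]
    split_ifs <;> simp
  | succ j ih =>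
    rw [walksOfLength, Finset.card_biUnion]
    · simp [pow_succ', Matrix.mul_apply, ih, Finset.sum_filter,
        Finset.card_image_of_injective _ List.cons_injective]
    · intro a _ b _ hab
      rw [Function.onFun, Finset.disjoint_left]
      simp only [Finset.mem_image]
      rintro _ ⟨l, -, rfl⟩ ⟨l', -, h⟩
      exact hab (List.cons_eq_cons.1 h).1.symm

variable (R) in
/-- The walks from `u` to `v` of length at most `k`, written without their first vertex. -/
def walksUpTo (k : ℕ) (u v : V) : Finset (List V) :=
  (Finset.range (k + 1)).biUnion fun j => walksOfLength R j u v

theorem mem_walksUpTo {k : ℕ} : l ∈ walksUpTo R k u v ↔ IsWalkFrom R u v l ∧ l.length ≤ k := by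
  simp [walksUpTo, mem_walksOfLength, and_comm]

theorem sum_adjMatrix_pow_apply (k : ℕ) :
    (∑ j ∈ Finset.range (k + 1), (Matrix.of fun u v => if R u v then (1 : ℚ) else 0) ^ j) u v =
      (walksUpTo R k u v).card := by
  rw [walksUpTo, Finset.card_biUnion, Matrix.sum_apply, Nat.cast_sum]
  · exact Finset.sum_congr rfl fun j _ => adjMatrix_pow_apply j
  · intro a _ b _ hab
    rw [Function.onFun, Finset.disjoint_left]
    simp only [mem_walksOfLength]
    rintro l ⟨-, h⟩ ⟨-, h'⟩
    exact hab (h.symm.trans h')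

end

namespace AlmostMooreDigraph

variable {d k : ℕ} (M : AlmostMooreDigraph d k)

theorem eq_nil_of_isWalkFrom_self {u : M.V} {l : List M.V} (h : IsWalkFrom M.Adj u u l)
    (hl : l.length < k) : l = [] := by
  have hnil : IsWalkFrom M.Adj u u [] := isWalkFrom_nil.2 rfl
  by_cases hu : u = M.rep u
  · obtain ⟨l₁, l₂, -, -, -, -, -, hk, hall⟩ := M.rep_two u
    rw [← hu] at hall
    have h1 := hall _ hnil (Nat.zero_le k)
    have h2 := hall _ h hl.le
    have hk1 := M.hk
    by_contra hne
    rcases h1 with rfl | rfl <;> rcases h2 with rfl | rfl <;>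
      first | exact hne rfl | (rw [List.length_nil] at hk; omega)
  · exact (M.rep_spec u u hu).unique ⟨h, hl.le⟩ ⟨hnil, Nat.zero_le k⟩

/-- A self-repeat lies on a closed walk of length `k`, unique among the nonempty closed walks of
length at most `k`. -/
theorem exists_closed_walk {u : M.V} (hu : M.rep u = u) :
    ∃ l, l.length = k ∧ IsWalkFrom M.Adj u u l ∧
      ∀ l', IsWalkFrom M.Adj u u l' → l'.length ≤ k → l' = [] ∨ l' = l := by
  obtain ⟨l₁, l₂, -, h₁, -, h₂, -, hk, hall⟩ := M.rep_two u
  rw [hu] at hall h₁ h₂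
  have hk1 := M.hk
  rcases hall [] (isWalkFrom_nil.2 rfl) (Nat.zero_le k) with rfl | rfl
  · exact ⟨l₂, by rcases hk with hk | hk; (simp at hk; omega); exact hk, h₂, hall⟩
  · exact ⟨l₁, by rcases hk with hk | hk; exact hk; (simp at hk; omega), h₁,
      fun l h hl => (hall l h hl).symm⟩

/-- The repeat map as a permutation. -/
noncomputable def repPerm : Equiv.Perm M.V := Equiv.ofBijective M.rep M.rep_bijective

theorem repPerm_apply (u : M.V) : M.repPerm u = M.rep u := rfl

theorem adj_repPerm_pow (n : ℕ) (a b : M.V) :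
    M.Adj ((M.repPerm ^ n) a) ((M.repPerm ^ n) b) ↔ M.Adj a b := by
  induction n with
  | zero => simp
  | succ n ih =>
    rw [pow_succ', Equiv.Perm.mul_apply, Equiv.Perm.mul_apply, repPerm_apply, repPerm_apply,
      ← M.rep_adj, ih]

theorem isWalkFrom_map_repPerm_pow {u v : M.V} {l : List M.V} (n : ℕ)
    (h : IsWalkFrom M.Adj u v l) :
    IsWalkFrom M.Adj ((M.repPerm ^ n) u) ((M.repPerm ^ n) v) (l.map (M.repPerm ^ n)) :=
  (isWalkFrom_map _ (Equiv.injective _) (M.adj_repPerm_pow n)).2 h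

/-- The vertices fixed by the `m`-th power of the repeat map. -/
abbrev Fixed (m : ℕ) : Type := {v : M.V // (M.repPerm ^ m) v = v}

theorem repPerm_pow_repPerm (m : ℕ) (v : M.V) :
    (M.repPerm ^ m) (M.repPerm v) = M.repPerm ((M.repPerm ^ m) v) := by
  rw [← Equiv.Perm.mul_apply, ← pow_succ, pow_succ', Equiv.Perm.mul_apply]

/-- The repeat map, restricted to the vertices fixed by its `m`-th power. -/
noncomputable def fixedPerm (m : ℕ) : Equiv.Perm (M.Fixed m) :=
  M.repPerm.subtypePerm fun v => by rw [repPerm_pow_repPerm, EmbeddingLike.apply_eq_iff_eq]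

theorem coe_fixedPerm (m : ℕ) (v : M.Fixed m) : (M.fixedPerm m v : M.V) = M.rep v := rfl

theorem coe_fixedPerm_pow (m j : ℕ) (v : M.Fixed m) :
    ((M.fixedPerm m ^ j) v : M.V) = (M.repPerm ^ j) v := by
  rw [fixedPerm, Equiv.Perm.subtypePerm_pow, Equiv.Perm.subtypePerm_apply]

theorem fixedPerm_pow_self (m : ℕ) : M.fixedPerm m ^ m = 1 := by
  ext v
  rw [coe_fixedPerm_pow, Equiv.Perm.one_apply, v.2]

/-- Adjacency between the vertices fixed by the `m`-th power of the repeat map. -/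
abbrev FixedAdj (m : ℕ) (a b : M.Fixed m) : Prop := M.Adj a b

theorem isWalkFrom_map_coe {m : ℕ} {u v : M.Fixed m} {l : List (M.Fixed m)} :
    IsWalkFrom M.Adj (u : M.V) v (l.map Subtype.val) ↔ IsWalkFrom (M.FixedAdj m) u v l :=
  isWalkFrom_map _ Subtype.val_injective fun _ _ => Iff.rfl

theorem exists_map_coe_eq {m : ℕ} {l : List M.V} (h : l.map (M.repPerm ^ m) = l) :
    ∃ l' : List (M.Fixed m), l'.map Subtype.val = l := by
  lift l to List (M.Fixed m) using fun v hv => by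
    have := List.map_eq_iff.1 h
    exact List.map_inj_left.1 (h.trans l.map_id.symm) v hv
  exact ⟨l, rfl⟩

theorem card_walksUpTo_of_ne {m : ℕ} {u w : M.Fixed m} (h : (w : M.V) ≠ M.rep u) :
    (walksUpTo (M.FixedAdj m) k u w).card = 1 := by
  obtain ⟨l, ⟨hl, hlk⟩, huniq⟩ := M.rep_spec u w h
  have hmap := M.isWalkFrom_map_repPerm_pow m hl
  rw [u.2, w.2] at hmap
  obtain ⟨l', rfl⟩ := M.exists_map_coe_eq (huniq _ ⟨hmap, by rwa [List.length_map]⟩)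
  rw [Finset.card_eq_one]
  refine ⟨l', Finset.eq_singleton_iff_unique_mem.2 ⟨?_, fun l₂ h₂ => ?_⟩⟩
  · rw [List.length_map] at hlk
    exact mem_walksUpTo.2 ⟨M.isWalkFrom_map_coe.1 hl, hlk⟩
  · rw [mem_walksUpTo, ← M.isWalkFrom_map_coe, ← l₂.length_map (f := Subtype.val)] at h₂
    exact Subtype.val_injective.list_map (huniq _ h₂)

theorem card_walksUpTo_self {m : ℕ} {u : M.Fixed m} (hu : M.rep u = u) :
    (walksUpTo (M.FixedAdj m) k u u).card = 2 := by
  obtain ⟨l, hlk, hl, huniq⟩ := M.exists_closed_walk hu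
  have hk1 := M.hk
  have hne : l ≠ [] := by rintro rfl; simp at hlk; omega
  have hmap := M.isWalkFrom_map_repPerm_pow m hl
  rw [u.2] at hmap
  obtain ⟨l', rfl⟩ := M.exists_map_coe_eq
    ((huniq _ hmap (by rw [List.length_map, hlk])).resolve_left (by simpa using hne))
  rw [Finset.card_eq_two]
  refine ⟨[], l', fun h => hne (by rw [← h, List.map_nil]), ?_⟩
  ext l₂
  rw [Finset.mem_insert, Finset.mem_singleton, mem_walksUpTo]
  constructor
  · rintro ⟨h, hlen⟩
    rw [← M.isWalkFrom_map_coe] at h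
    exact (huniq _ h (by rwa [List.length_map])).imp List.map_eq_nil_iff.1
      fun h => Subtype.val_injective.list_map h
  · rintro (rfl | rfl)
    · exact ⟨isWalkFrom_nil.2 rfl, Nat.zero_le k⟩
    · exact ⟨M.isWalkFrom_map_coe.1 hl, by rw [List.length_map] at hlk; exact hlk.le⟩

/-- A self-repeat has an out-neighbour that is a self-repeat. -/
theorem exists_adj_rep_eq {u : M.V} (hu : M.rep u = u) : ∃ c, M.Adj u c ∧ M.rep c = c := by
  obtain ⟨l, hlk, hl, huniq⟩ := M.exists_closed_walk hu
  have hk1 := M.hk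
  cases l with
  | nil => simp at hlk; omega
  | cons c l =>
    have hmap := M.isWalkFrom_map_repPerm_pow 1 hl
    rw [pow_one, repPerm_apply, hu] at hmap
    have := (huniq _ hmap (by rw [List.length_map, hlk])).resolve_left (by simp)
    exact ⟨c, (isWalkFrom_cons.1 hl).1, (List.cons_eq_cons.1 this).1⟩

/-- Beside a given out-neighbour fixed by the repeat map, a self-repeat has another out-neighbour
whose orbit under the repeat map has fewer than `d` elements. -/
theorem exists_adj_repPerm_pow_eq {u c : M.V} (hu : M.rep u = u) (hc : M.Adj u c)
    (hcr : M.rep c = c) :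
    ∃ x m, M.Adj u x ∧ x ≠ c ∧ m ≠ 0 ∧ m < d ∧ (M.repPerm ^ m) x = x := by
  have hd := M.hd
  obtain ⟨x, hx, hxc⟩ := Set.exists_ne_of_one_lt_ncard (M.out_deg u ▸ hd) c
  refine ⟨x, Function.minimalPeriod M.repPerm x, hx, hxc,
    (Function.minimalPeriod_pos_of_mem_periodicPts
      (M.repPerm.injective.mem_periodicPts x)).ne', ?_, ?_⟩
  · have hsub : (fun n => M.repPerm^[n] x) '' Set.Iio (Function.minimalPeriod M.repPerm x) ⊆
        {w | M.Adj u w} \ {c} := by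
      rintro _ ⟨n, -, rfl⟩
      induction n with
      | zero => exact ⟨hx, hxc⟩
      | succ n ih =>
        simp only [Function.iterate_succ_apply', repPerm_apply] at ih ⊢
        refine ⟨?_, fun h => ih.2 (M.rep_bijective.1 (h.trans hcr.symm))⟩
        have := (M.rep_adj _ _).1 ih.1
        rwa [hu] at this
    have hle := Set.ncard_le_ncard hsub
    rw [Function.iterate_injOn_Iio_minimalPeriod.ncard_image,
      Set.ncard_sdiff_singleton_of_mem (show c ∈ {w | M.Adj u w} from hc), M.out_deg] at hle
    simp at hle
    omega
  · rw [← Equiv.Perm.iterate_eq_pow]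
    exact Function.isPeriodicPt_minimalPeriod _ x

theorem rep_ne (hd : d ≤ 12) (hk : 2 < k) (v : M.V) : M.rep v ≠ v := by
  intro hv
  obtain ⟨c, hc, hcr⟩ := M.exists_adj_rep_eq hv
  obtain ⟨x, m, hx, hxc, hm, hmd, hxm⟩ := M.exists_adj_repPerm_pow_eq hv hc hcr
  have hfix : ∀ y, M.rep y = y → (M.repPerm ^ m) y = y := fun y hy =>
    Equiv.Perm.pow_apply_eq_self_of_apply_eq_self hy m
  let v' : M.Fixed m := ⟨v, hfix v hv⟩
  let c' : M.Fixed m := ⟨c, hfix c hcr⟩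
  let x' : M.Fixed m := ⟨x, hxm⟩
  refine Matrix.not_quasi_moore (ρ := M.fixedPerm m) (v₀ := v')
    (A := Matrix.of fun a b => if M.FixedAdj m a b then (1 : ℚ) else 0)
    (ε := fun u => ((walksUpTo (M.FixedAdj m) k u (M.fixedPerm m u)).card : ℚ) - 1)
    hk hm (by omega) (M.fixedPerm_pow_self m) ?_ ?_ ?_ ?_ ?_ ?_ ?_ ?_
  · intro u w
    rw [sum_adjMatrix_pow_apply]
    split_ifs with h
    · rw [h]; ring
    · rw [M.card_walksUpTo_of_ne fun h' => h (Subtype.ext h'), Nat.cast_one]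
  · intro a b
    rw [Matrix.of_apply]
    split_ifs <;> simp
  · intro a b
    simp only [Matrix.of_apply, FixedAdj, coe_fixedPerm, ← M.rep_adj]
  · intro j hj hjk u
    rw [adjMatrix_pow_apply, Nat.cast_eq_zero, Finset.card_eq_zero,
      Finset.eq_empty_iff_forall_notMem]
    intro l hl
    rw [mem_walksOfLength, ← M.isWalkFrom_map_coe] at hl
    have := M.eq_nil_of_isWalkFrom_self hl.1 (by rwa [List.length_map, hl.2])
    rw [← hl.2, List.map_eq_nil_iff.1 this] at hj
    exact hj.ne rfl
  · have h : M.fixedPerm m v' = v' := Subtype.ext hv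
    simp only [h]
    rw [M.card_walksUpTo_self (show M.rep v' = v' from hv)]
    norm_num
  · intro w
    have hne : (walksUpTo (M.FixedAdj m) k v' w).Nonempty := by
      rw [← Finset.card_pos]
      by_cases h : w = v'
      · rw [h, M.card_walksUpTo_self (show M.rep v' = v' from hv)]
        exact two_pos
      · rw [M.card_walksUpTo_of_ne fun h' => h (Subtype.ext (h'.trans hv))]
        exact one_pos
    obtain ⟨l, hl⟩ := hne
    refine Relation.ReflTransGen.mono (fun a b hab => ?_) _ _
      (mem_walksUpTo.1 hl).1.reflTransGen
    rw [Matrix.of_apply, if_pos hab]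
  · simp only [Matrix.of_apply, Finset.sum_boole, Nat.one_lt_cast]
    rw [Finset.one_lt_card]
    exact ⟨c', by simpa using hc, x', by simpa using hx, fun h => hxc (Subtype.ext_iff.1 h).symm⟩
  · intro hk4 j hj u
    rw [Matrix.of_apply, if_neg]
    intro (hadj : M.Adj _ _)
    rw [coe_fixedPerm_pow] at hadj
    have h1 := (M.adj_repPerm_pow j _ _).2 hadj
    have h2 := (M.adj_repPerm_pow j _ _).2 h1
    have h3 : (M.repPerm ^ j) ((M.repPerm ^ j) ((M.repPerm ^ j) u)) = (u : M.V) := by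
      rw [← Equiv.Perm.mul_apply, ← Equiv.Perm.mul_apply, ← pow_add, ← pow_add,
        show j + j + j = 3 * j by ring, ← coe_fixedPerm_pow, hj, Equiv.Perm.one_apply]
    rw [h3] at h2
    exact List.cons_ne_nil _ _ (M.eq_nil_of_isWalkFrom_self
      (isWalkFrom_cons.2 ⟨h2, isWalkFrom_cons.2 ⟨h1, isWalkFrom_cons.2 ⟨hadj,
        isWalkFrom_nil.2 rfl⟩⟩⟩)
      (by simp [hk4]))

end AlmostMooreDigraph

/-- For every degree `d` with `6 ≤ d ≤ 12` and every diameter `k > 2`,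
there is no almost Moore digraph of degree `d` and diameter `k` with self-repeats. -/
theorem stmt18 (d k : ℕ) (hd₁ : 6 ≤ d) (hd₂ : d ≤ 12) (hk : 2 < k) :
    ¬ ∃ M : AlmostMooreDigraph d k, ∃ v : M.V, M.rep v = v := by
  rintro ⟨M, v, hv⟩
  exact M.rep_ne hd₂ hk v hv
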